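/- arXiv:1010.6165 — 7 statements merged into one kernel-verified Lean document; each statement's English description precedes it below -/
import Mathlib

section
/- Let M ⊆ ℝ² be open with Lebesgue measure μ(M) > 1 (possibly infinite). Then for every tempered distribution g (i.e., every continuous linear functional on the Schwartz space 𝓢(ℝ)) and every ε > 0 there exists a smooth, compactly supported, not identically zero η : ℝ² → ℂ with supp η ⊆ M such that the function Hg : ℝ → ℂ defined by Hg(x) = g(y ↦ ∫_ℝ η(x − y, ν)·e^{2πiνx} dν) (the argument of g is a smooth compactly supported, hence Schwartz, function of y for each fixed x) satisfies ‖Hg‖_{L²(ℝ)} ≤ ε·‖η‖_{L²(ℝ²)}. -/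
open MeasureTheory Real SchwartzMap

/-- The character `y ↦ e^{2πiqy}` of the real line. -/
noncomputable def realChar (q y : ℝ) : ℂ := Complex.exp (2 * π * Complex.I * q * y)

lemma norm_realChar (q y : ℝ) : ‖realChar q y‖ = 1 := by
  have : (2 * π * Complex.I * q * y : ℂ) = ((2 * π * q * y : ℝ) : ℂ) * Complex.I := by
    push_cast; ring
  rw [realChar, this, Complex.norm_exp_ofReal_mul_I]

lemma contDiff_realChar (q : ℝ) {n : WithTop ℕ∞} : ContDiff ℝ n (realChar q) := by
  unfold realChar
  exact (contDiff_const.mul Complex.ofRealCLM.contDiff).cexp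

lemma continuous_realChar (q : ℝ) : Continuous (realChar q) := (contDiff_realChar q (n := 0)).continuous

lemma realChar_add_right (q x y : ℝ) : realChar q (x + y) = realChar q x * realChar q y := by
  simp only [realChar, ← Complex.exp_add]; congr 1; push_cast; ring

lemma realChar_add_left (p q y : ℝ) : realChar (p + q) y = realChar p y * realChar q y := by
  simp only [realChar, ← Complex.exp_add]; congr 1; push_cast; ring

lemma iteratedDeriv_realChar (q : ℝ) (n : ℕ) :
    iteratedDeriv n (realChar q) = fun y => (2 * π * Complex.I * q) ^ n * realChar q y := by
  induction n with
  | zero => simp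
  | succ n ih =>
    rw [iteratedDeriv_succ, ih]
    ext y
    have h : HasDerivAt (realChar q) (realChar q y * (2 * π * Complex.I * q)) y := by
      have := ((Complex.ofRealCLM.hasDerivAt (x := y)).const_mul (2 * π * Complex.I * q)).cexp
      simp only [Complex.ofRealCLM_apply, Complex.ofReal_one, mul_one] at this
      exact this
    rw [(h.const_mul _).deriv]; ring

lemma norm_iteratedFDeriv_realChar (q : ℝ) (n : ℕ) (y : ℝ) :
    ‖iteratedFDeriv ℝ n (realChar q) y‖ = (2 * π * |q|) ^ n := by
  rw [norm_iteratedFDeriv_eq_norm_iteratedDeriv, iteratedDeriv_realChar]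
  simp [norm_realChar, abs_of_pos pi_pos]

lemma hasTemperateGrowth_realChar (q : ℝ) : (realChar q).HasTemperateGrowth := by
  refine ⟨contDiff_realChar q, fun n => ⟨0, (2 * π * |q|) ^ n, fun y => ?_⟩⟩
  rw [norm_iteratedFDeriv_realChar]; simp

/-- The time-frequency shift `y ↦ e^{2πiqy} ψ(y - x)`. -/
noncomputable def timeFreqShift (q x : ℝ) (ψ : 𝓢(ℝ, ℂ)) : 𝓢(ℝ, ℂ) :=
  smulLeftCLM ℂ (realChar q) (compSubConstCLM ℂ x ψ)

lemma timeFreqShift_apply (q x : ℝ) (ψ : 𝓢(ℝ, ℂ)) (y : ℝ) :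
    timeFreqShift q x ψ y = realChar q y * ψ (y - x) := by
  rw [timeFreqShift, smulLeftCLM_apply_apply (hasTemperateGrowth_realChar q),
    compSubConstCLM_apply, smul_eq_mul]

lemma seminorm_timeFreqShift_le (ψ : 𝓢(ℝ, ℂ)) (k n : ℕ) :
    ∃ C, 0 ≤ C ∧ ∀ q x : ℝ, SchwartzMap.seminorm ℂ k n (timeFreqShift q x ψ) ≤
      C * ((1 + |x|) ^ k * (1 + |q|) ^ n) := by
  have hD : ∀ i, ∃ D, 0 ≤ D ∧ ∀ z : ℝ, (1 + |z|) ^ k * ‖iteratedFDeriv ℝ i ψ z‖ ≤ D := fun i =>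
    ⟨2 ^ k * ((Finset.Iic (k, i)).sup fun m => SchwartzMap.seminorm ℂ m.1 m.2) ψ,
      by positivity, fun z => by
      simpa using one_add_le_sup_seminorm_apply (𝕜 := ℂ) (m := (k, i)) le_rfl le_rfl ψ z⟩
  choose D hD0 hD using hD
  refine ⟨∑ i ∈ Finset.range (n + 1), n.choose i * (2 * π) ^ i * D (n - i), ?_, fun q x => ?_⟩
  · exact Finset.sum_nonneg fun i _ => by have := hD0 (n - i); positivity
  refine seminorm_le_bound ℂ k n _ (by
    refine mul_nonneg (Finset.sum_nonneg fun i _ => ?_) (by positivity)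
    have := hD0 (n - i); positivity) fun y => ?_
  have hfun : (timeFreqShift q x ψ : ℝ → ℂ) = fun y => realChar q y * ψ (y - x) := by
    ext y; exact timeFreqShift_apply q x ψ y
  rw [hfun]
  have h1 := norm_iteratedFDeriv_mul_le (n := n) (N := n) (contDiff_realChar q)
    ((ψ.smooth n).comp (contDiff_id.sub (contDiff_const (c := x)))) y le_rfl
  simp only [Function.comp_def, id] at h1
  refine (mul_le_mul_of_nonneg_left h1 (by positivity)).trans ?_
  rw [Finset.mul_sum, Finset.sum_mul]
  refine Finset.sum_le_sum fun i hi => ?_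
  have hi' : i ≤ n := by simpa [Nat.lt_succ_iff] using hi
  rw [norm_iteratedFDeriv_realChar, iteratedFDeriv_comp_sub]
  have hy : ‖y‖ ^ k ≤ (1 + |x|) ^ k * (1 + |y - x|) ^ k := by
    rw [← mul_pow]
    refine pow_le_pow_left₀ (norm_nonneg _) ?_ _
    have : |y| ≤ |x| + |y - x| := by
      simpa using abs_add_le x (y - x)
    rw [Real.norm_eq_abs]
    nlinarith [abs_nonneg x, abs_nonneg (y - x)]
  have hq : |q| ^ i ≤ (1 + |q|) ^ n := by
    calc |q| ^ i ≤ (1 + |q|) ^ i := by gcongr; linarith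
      _ ≤ _ := pow_le_pow_right₀ (by linarith [abs_nonneg q]) hi'
  have h2 := hD (n - i) (y - x)
  calc ‖y‖ ^ k * (n.choose i * (2 * π * |q|) ^ i * ‖iteratedFDeriv ℝ (n - i) ψ (y - x)‖)
      ≤ ((1 + |x|) ^ k * (1 + |y - x|) ^ k) *
        (n.choose i * ((2 * π) ^ i * (1 + |q|) ^ n) * ‖iteratedFDeriv ℝ (n - i) ψ (y - x)‖) := by
        rw [mul_pow (2 * π)]; gcongr
    _ = (n.choose i * (2 * π) ^ i) * ((1 + |x|) ^ k * (1 + |q|) ^ n) *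
        ((1 + |y - x|) ^ k * ‖iteratedFDeriv ℝ (n - i) ψ (y - x)‖) := by ring
    _ ≤ (n.choose i * (2 * π) ^ i) * ((1 + |x|) ^ k * (1 + |q|) ^ n) * D (n - i) := by gcongr
    _ = _ := by ring

/-- A tempered distribution grows at most polynomially along time-frequency shifts. -/
lemma exists_norm_apply_timeFreqShift_le (g : 𝓢(ℝ, ℂ) →L[ℂ] ℂ) :
    ∃ m : ℕ, ∀ ψ : 𝓢(ℝ, ℂ), ∃ C, 0 ≤ C ∧ ∀ q x : ℝ,
      ‖g (timeFreqShift q x ψ)‖ ≤ C * ((1 + |x|) ^ m * (1 + |q|) ^ m) := by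
  obtain ⟨s, C, -, hC⟩ := Seminorm.bound_of_continuous (schwartz_withSeminorms ℂ ℝ ℂ)
    (g.toSeminorm) (by exact g.continuous.norm)
  refine ⟨s.sup Prod.fst + s.sup Prod.snd, fun ψ => ?_⟩
  choose A hA0 hA using fun i : ℕ × ℕ => seminorm_timeFreqShift_le ψ i.1 i.2
  refine ⟨C * ∑ i ∈ s, A i, mul_nonneg C.2 (Finset.sum_nonneg fun i _ => hA0 i), fun q x => ?_⟩
  have h1 := hC (timeFreqShift q x ψ)
  have h2 : (s.sup (schwartzSeminormFamily ℂ ℝ ℂ)) (timeFreqShift q x ψ) ≤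
      ∑ i ∈ s, schwartzSeminormFamily ℂ ℝ ℂ i (timeFreqShift q x ψ) := by
    simpa using Seminorm.finset_sup_le_sum (schwartzSeminormFamily ℂ ℝ ℂ) s (timeFreqShift q x ψ)
  refine le_trans (show _ ≤ _ from h1) ?_
  rw [smul_apply, NNReal.smul_def, smul_eq_mul, mul_assoc]
  refine mul_le_mul_of_nonneg_left (h2.trans ?_) C.2
  rw [Finset.sum_mul]
  refine Finset.sum_le_sum fun i hi => (hA i q x).trans ?_
  refine mul_le_mul_of_nonneg_left ?_ (hA0 i)
  have hx : (1 : ℝ) ≤ 1 + |x| := by linarith [abs_nonneg x]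
  have hq : (1 : ℝ) ≤ 1 + |q| := by linarith [abs_nonneg q]
  have h3 := Finset.le_sup (f := Prod.fst) hi
  have h4 := Finset.le_sup (f := Prod.snd) hi
  gcongr
  · exact h3.trans (Nat.le_add_right _ _)
  · exact h4.trans (Nat.le_add_left _ _)

/-- First-order Taylor estimate. -/
lemma norm_sub_sub_mul_deriv_le {F F' F'' : ℝ → ℂ} (h1 : ∀ z, HasDerivAt F (F' z) z)
    (h2 : ∀ z, HasDerivAt F' (F'' z) z) (z h B : ℝ)
    (hB : ∀ w ∈ Set.uIcc z (z + h), ‖F'' w‖ ≤ B) :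
    ‖F (z + h) - F z - h * F' z‖ ≤ B * |h| ^ 2 := by
  have hz : z ∈ Set.uIcc z (z + h) := Set.left_mem_uIcc
  have hzh : z + h ∈ Set.uIcc z (z + h) := Set.right_mem_uIcc
  have hB0 : 0 ≤ B := (norm_nonneg _).trans (hB z hz)
  have key1 : ∀ w ∈ Set.uIcc z (z + h), ‖F' w - F' z‖ ≤ B * |h| := by
    intro w hw
    have := (convex_uIcc z (z + h)).norm_image_sub_le_of_norm_hasDerivWithin_le
      (fun v _ => (h2 v).hasDerivWithinAt) hB hz hw
    refine this.trans (mul_le_mul_of_nonneg_left ?_ hB0)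
    simpa using Set.abs_sub_left_of_mem_uIcc hw
  have key2 := (convex_uIcc z (z + h)).norm_image_sub_le_of_norm_hasDerivWithin_le
      (f := fun w => F w - (w - z : ℝ) * F' z) (f' := fun w => F' w - F' z) (C := B * |h|)
      (fun v _ => by
        have h3 : HasDerivAt (fun w : ℝ => ((w - z : ℝ) : ℂ) * F' z) (F' z) v := by
          have := (((hasDerivAt_id v).sub_const z).ofReal_comp).mul_const (F' z)
          simpa using this
        exact ((h1 v).sub h3).hasDerivWithinAt) key1 hz hzh
  calc _ = _ := by congr 1; simp; ring
    _ ≤ _ := key2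
    _ = _ := by rw [add_sub_cancel_left, Real.norm_eq_abs]; ring

lemma hasDerivAt_iteratedDeriv (ψ : 𝓢(ℝ, ℂ)) (n : ℕ) (z : ℝ) :
    HasDerivAt (iteratedDeriv n ψ) (iteratedDeriv (n + 1) ψ z) z := by
  rw [iteratedDeriv_succ]
  exact ((ψ.smooth (n + 1 : ℕ)).differentiable_iteratedDeriv n (by norm_cast; simp) z).hasDerivAt

lemma iteratedDeriv_compSubConstCLM (ψ : 𝓢(ℝ, ℂ)) (n : ℕ) (x y : ℝ) :
    iteratedDeriv n (compSubConstCLM ℂ x ψ) y = iteratedDeriv n ψ (y - x) := by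
  have : (compSubConstCLM ℂ x ψ : ℝ → ℂ) = fun y => ψ (y - x) := by
    ext y; exact compSubConstCLM_apply ψ x y
  rw [this, iteratedDeriv_comp_sub_const]

/-- Translation is differentiable in the Schwartz space, up to a quadratic error. -/
lemma seminorm_compSubConstCLM_sub_le (ψ : 𝓢(ℝ, ℂ)) (x : ℝ) (k n : ℕ) :
    ∃ C, 0 ≤ C ∧ ∀ h : ℝ, |h| ≤ 1 → SchwartzMap.seminorm ℂ k n
      (compSubConstCLM ℂ (x + h) ψ - compSubConstCLM ℂ x ψ
        + (h : ℂ) • compSubConstCLM ℂ x (derivCLM ℂ ℂ ψ)) ≤ C * |h| ^ 2 := by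
  obtain ⟨D, hD0, hD⟩ : ∃ D, 0 ≤ D ∧ ∀ z : ℝ, (1 + |z|) ^ k * ‖iteratedDeriv (n + 2) ψ z‖ ≤ D :=
    ⟨2 ^ k * ((Finset.Iic (k, n + 2)).sup fun m => SchwartzMap.seminorm ℂ m.1 m.2) ψ,
      by positivity, fun z => by
      simpa [norm_iteratedFDeriv_eq_norm_iteratedDeriv] using
        one_add_le_sup_seminorm_apply (𝕜 := ℂ) (m := (k, n + 2)) le_rfl le_rfl ψ z⟩
  refine ⟨(1 + |x|) ^ k * (2 ^ k * D), by positivity, fun h hh => ?_⟩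
  refine seminorm_le_bound' ℂ k n _ (by positivity) fun y => ?_
  have hfun : iteratedDeriv n (compSubConstCLM ℂ (x + h) ψ - compSubConstCLM ℂ x ψ
        + (h : ℂ) • compSubConstCLM ℂ x (derivCLM ℂ ℂ ψ) : 𝓢(ℝ, ℂ)) y =
      iteratedDeriv n ψ (y - x + -h) - iteratedDeriv n ψ (y - x)
        - (-h : ℝ) * iteratedDeriv (n + 1) ψ (y - x) := by
    have e1 : ((compSubConstCLM ℂ (x + h) ψ - compSubConstCLM ℂ x ψ
        + (h : ℂ) • compSubConstCLM ℂ x (derivCLM ℂ ℂ ψ) : 𝓢(ℝ, ℂ)) : ℝ → ℂ) =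
      ((compSubConstCLM ℂ (x + h) ψ : ℝ → ℂ) - (compSubConstCLM ℂ x ψ : ℝ → ℂ))
        + (h : ℂ) • (compSubConstCLM ℂ x (derivCLM ℂ ℂ ψ) : ℝ → ℂ) := by
      ext y; simp
    have c1 := ((compSubConstCLM ℂ (x + h) ψ).smooth n).contDiffAt (x := y)
    have c2 := ((compSubConstCLM ℂ x ψ).smooth n).contDiffAt (x := y)
    have c3 := ((compSubConstCLM ℂ x (derivCLM ℂ ℂ ψ)).smooth n).contDiffAt (x := y)
    have c4 : ContDiffAt ℝ n
        ((compSubConstCLM ℂ (x + h) ψ : ℝ → ℂ) - (compSubConstCLM ℂ x ψ : ℝ → ℂ)) y := c1.sub c2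
    have c5 : ContDiffAt ℝ n
        ((h : ℂ) • (compSubConstCLM ℂ x (derivCLM ℂ ℂ ψ) : ℝ → ℂ)) y := contDiffAt_const.smul c3
    rw [e1, iteratedDeriv_add c4 c5, iteratedDeriv_sub c1 c2,
      iteratedDeriv_const_smul c3, iteratedDeriv_compSubConstCLM, iteratedDeriv_compSubConstCLM,
      iteratedDeriv_compSubConstCLM]
    have e2 : (derivCLM ℂ ℂ ψ : ℝ → ℂ) = deriv ψ := by ext; simp
    rw [e2, ← iteratedDeriv_succ', show y - (x + h) = y - x + -h by ring]
    simp
  rw [hfun]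
  have ht := norm_sub_sub_mul_deriv_le (hasDerivAt_iteratedDeriv ψ n)
    (hasDerivAt_iteratedDeriv ψ (n + 1)) (y - x) (-h) (2 ^ k * D / (1 + |y - x|) ^ k) (by
      intro w hw
      have hw' : |w - (y - x)| ≤ 1 := by
        refine le_trans (Set.abs_sub_left_of_mem_uIcc hw) ?_
        simpa using hh
      have h1 : (1 + |y - x|) ^ k ≤ 2 ^ k * (1 + |w|) ^ k := by
        rw [← mul_pow]
        refine pow_le_pow_left₀ (by positivity) ?_ _
        have : |y - x| ≤ |w| + |w - (y - x)| := by
          have := abs_sub_abs_le_abs_sub (y - x) w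
          rw [abs_sub_comm (y - x) w] at this
          linarith
        linarith [abs_nonneg w]
      rw [le_div_iff₀ (by positivity)]
      calc _ ≤ ‖iteratedDeriv (n + 2) ψ w‖ * (2 ^ k * (1 + |w|) ^ k) := by gcongr
        _ = 2 ^ k * ((1 + |w|) ^ k * ‖iteratedDeriv (n + 2) ψ w‖) := by ring
        _ ≤ _ := by gcongr; exact hD w)
  have hy : |y| ^ k ≤ (1 + |x|) ^ k * (1 + |y - x|) ^ k := by
    rw [← mul_pow]
    refine pow_le_pow_left₀ (abs_nonneg _) ?_ _
    have : |y| ≤ |x| + |y - x| := by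
      simpa using abs_add_le x (y - x)
    nlinarith [abs_nonneg x, abs_nonneg (y - x)]
  rw [abs_neg] at ht
  calc _ ≤ ((1 + |x|) ^ k * (1 + |y - x|) ^ k) * (2 ^ k * D / (1 + |y - x|) ^ k * |h| ^ 2) := by
        gcongr
    _ = _ := by
      have : (1 + |y - x|) ^ k ≠ 0 := by positivity
      field_simp

lemma hasDerivAt_apply_compSubConstCLM (g : 𝓢(ℝ, ℂ) →L[ℂ] ℂ) (ψ : 𝓢(ℝ, ℂ)) (x : ℝ) :
    HasDerivAt (fun x => g (compSubConstCLM ℂ x ψ))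
      (-g (compSubConstCLM ℂ x (derivCLM ℂ ℂ ψ))) x := by
  obtain ⟨s, C, -, hC⟩ := Seminorm.bound_of_continuous (schwartz_withSeminorms ℂ ℝ ℂ)
    (g.toSeminorm) (by exact g.continuous.norm)
  choose A hA0 hA using fun i : ℕ × ℕ => seminorm_compSubConstCLM_sub_le ψ x i.1 i.2
  have key : ∀ h : ℝ, |h| ≤ 1 → ‖g (compSubConstCLM ℂ (x + h) ψ) - g (compSubConstCLM ℂ x ψ)
      - h • (-g (compSubConstCLM ℂ x (derivCLM ℂ ℂ ψ)))‖ ≤ (C * ∑ i ∈ s, A i) * |h| ^ 2 := by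
    intro h hh
    set Φ := compSubConstCLM ℂ (x + h) ψ - compSubConstCLM ℂ x ψ
        + (h : ℂ) • compSubConstCLM ℂ x (derivCLM ℂ ℂ ψ) with hΦ
    have e : g (compSubConstCLM ℂ (x + h) ψ) - g (compSubConstCLM ℂ x ψ)
      - h • (-g (compSubConstCLM ℂ x (derivCLM ℂ ℂ ψ))) = g Φ := by
      rw [hΦ, map_add, map_sub, map_smul]; simp
    rw [e]
    refine le_trans (show _ ≤ _ from hC Φ) ?_
    rw [smul_apply, NNReal.smul_def, smul_eq_mul, mul_assoc]
    refine mul_le_mul_of_nonneg_left ?_ C.2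
    have h2 : (s.sup (schwartzSeminormFamily ℂ ℝ ℂ)) Φ ≤
        ∑ i ∈ s, schwartzSeminormFamily ℂ ℝ ℂ i Φ := by
      simpa using Seminorm.finset_sup_le_sum (schwartzSeminormFamily ℂ ℝ ℂ) s Φ
    refine h2.trans ?_
    rw [Finset.sum_mul]
    exact Finset.sum_le_sum fun i _ => hA i h hh
  rw [hasDerivAt_iff_isLittleO_nhds_zero]
  refine (Asymptotics.IsBigO.of_bound (C * ∑ i ∈ s, A i) ?_ :
    _ =O[nhds 0] fun h : ℝ => h ^ 2).trans_isLittleO ?_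
  · filter_upwards [Metric.closedBall_mem_nhds (0 : ℝ) one_pos] with h hh
    have := key h (by simpa using hh)
    simpa using this
  · exact Asymptotics.isLittleO_pow_id one_lt_two

lemma hasDerivAt_apply_timeFreqShift (g : 𝓢(ℝ, ℂ) →L[ℂ] ℂ) (ψ : 𝓢(ℝ, ℂ)) (q x : ℝ) :
    HasDerivAt (fun x => g (timeFreqShift q x ψ))
      (-g (timeFreqShift q x (derivCLM ℂ ℂ ψ))) x :=
  hasDerivAt_apply_compSubConstCLM (g ∘L smulLeftCLM ℂ (realChar q)) ψ x

section Atoms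

variable {g : 𝓢(ℝ, ℂ) →L[ℂ] ℂ} {m : ℕ}

lemma exists_pow_mul_norm_mul_le
    (hg : ∀ ψ : 𝓢(ℝ, ℂ), ∃ C, 0 ≤ C ∧ ∀ q x : ℝ,
      ‖g (timeFreqShift q x ψ)‖ ≤ C * ((1 + |x|) ^ m * (1 + |q|) ^ m))
    (u ψ : 𝓢(ℝ, ℂ)) (n : ℕ) :
    ∃ C, 0 ≤ C ∧ ∀ p q x : ℝ, (1 + |x + p|) ^ n * ‖u (x + p) * g (timeFreqShift q x ψ)‖ ≤
      C * ((1 + |p|) ^ m * (1 + |q|) ^ m) := by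
  obtain ⟨C, hC0, hC⟩ := hg ψ
  obtain ⟨D, hD0, hD⟩ : ∃ D, 0 ≤ D ∧ ∀ z : ℝ, (1 + |z|) ^ (n + m) * ‖u z‖ ≤ D :=
    ⟨2 ^ (n + m) * ((Finset.Iic (n + m, 0)).sup fun m => SchwartzMap.seminorm ℂ m.1 m.2) u,
      by positivity, fun z => by
      simpa using one_add_le_sup_seminorm_apply (𝕜 := ℂ) (m := (n + m, 0)) le_rfl le_rfl u z⟩
  refine ⟨D * C, by positivity, fun p q x => ?_⟩
  have hx : (1 + |x|) ^ m ≤ (1 + |x + p|) ^ m * (1 + |p|) ^ m := by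
    rw [← mul_pow]
    refine pow_le_pow_left₀ (by positivity) ?_ _
    have : |x| ≤ |x + p| + |p| := by simpa using abs_sub (x + p) p
    nlinarith [abs_nonneg (x + p), abs_nonneg p]
  rw [norm_mul]
  calc (1 + |x + p|) ^ n * (‖u (x + p)‖ * ‖g (timeFreqShift q x ψ)‖)
      ≤ (1 + |x + p|) ^ n * (‖u (x + p)‖ *
        (C * (((1 + |x + p|) ^ m * (1 + |p|) ^ m) * (1 + |q|) ^ m))) := by
        gcongr
        refine (hC q x).trans ?_
        gcongr
    _ = ((1 + |x + p|) ^ (n + m) * ‖u (x + p)‖) * (C * ((1 + |p|) ^ m * (1 + |q|) ^ m)) := by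
        ring
    _ ≤ D * (C * ((1 + |p|) ^ m * (1 + |q|) ^ m)) := by gcongr; exact hD _
    _ = _ := by ring

lemma hasDerivAt_mul_apply_timeFreqShift (u ψ : 𝓢(ℝ, ℂ)) (p q x : ℝ) :
    HasDerivAt (fun x => u (x + p) * g (timeFreqShift q x ψ))
      (derivCLM ℂ ℂ u (x + p) * g (timeFreqShift q x ψ)
        - u (x + p) * g (timeFreqShift q x (derivCLM ℂ ℂ ψ))) x := by
  have h1 : HasDerivAt (fun x => u (x + p)) (derivCLM ℂ ℂ u (x + p)) x := by
    simpa using (u.hasDerivAt (x + p)).comp_add_const x p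
  exact (h1.mul (hasDerivAt_apply_timeFreqShift g ψ q x)).congr_deriv (by ring)

lemma continuous_mul_apply_timeFreqShift (u ψ : 𝓢(ℝ, ℂ)) (p q : ℝ) :
    Continuous fun x => u (x + p) * g (timeFreqShift q x ψ) :=
  continuous_iff_continuousAt.2 fun x =>
    (hasDerivAt_mul_apply_timeFreqShift u ψ p q x).continuousAt

lemma exists_integral_norm_le
    (hg : ∀ ψ : 𝓢(ℝ, ℂ), ∃ C, 0 ≤ C ∧ ∀ q x : ℝ,
      ‖g (timeFreqShift q x ψ)‖ ≤ C * ((1 + |x|) ^ m * (1 + |q|) ^ m))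
    (u ψ : 𝓢(ℝ, ℂ)) :
    ∃ C, 0 ≤ C ∧ ∀ p q : ℝ, Integrable (fun x => u (x + p) * g (timeFreqShift q x ψ)) ∧
      ∫ x, ‖u (x + p) * g (timeFreqShift q x ψ)‖ ≤ C * ((1 + |p|) ^ m * (1 + |q|) ^ m) := by
  obtain ⟨C, hC0, hC⟩ := exists_pow_mul_norm_mul_le hg u ψ 2
  refine ⟨C * π, by positivity, fun p q => ?_⟩
  set A := (1 + |p|) ^ m * (1 + |q|) ^ m
  have hb : ∀ x, ‖u (x + p) * g (timeFreqShift q x ψ)‖ ≤ C * A * (1 + (x + p) ^ 2)⁻¹ := by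
    intro x
    rw [← div_eq_mul_inv, le_div_iff₀ (by positivity), mul_comm]
    refine le_trans ?_ (hC p q x)
    gcongr
    nlinarith [abs_nonneg (x + p), sq_abs (x + p)]
  have hint : Integrable fun x : ℝ => C * A * (1 + (x + p) ^ 2)⁻¹ :=
    (integrable_inv_one_add_sq.comp_add_right p).const_mul _
  have hf := hint.mono' (continuous_mul_apply_timeFreqShift (g := g) u ψ p q).aestronglyMeasurable
    (Filter.Eventually.of_forall hb)
  refine ⟨hf, (integral_mono hf.norm hint hb).trans ?_⟩
  rw [integral_const_mul, integral_add_right_eq_self (fun x : ℝ => (1 + x ^ 2)⁻¹),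
    integral_univ_inv_one_add_sq]
  exact le_of_eq (by ring)

open FourierTransform in
lemma exists_pow_mul_norm_fourier_le
    (hg : ∀ ψ : 𝓢(ℝ, ℂ), ∃ C, 0 ≤ C ∧ ∀ q x : ℝ,
      ‖g (timeFreqShift q x ψ)‖ ≤ C * ((1 + |x|) ^ m * (1 + |q|) ^ m)) (n : ℕ) :
    ∀ u ψ : 𝓢(ℝ, ℂ), ∃ C, 0 ≤ C ∧ ∀ p q ξ : ℝ,
      |ξ| ^ n * ‖𝓕 (fun x => u (x + p) * g (timeFreqShift q x ψ)) ξ‖ ≤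
        C * ((1 + |p|) ^ m * (1 + |q|) ^ m) := by
  induction n with
  | zero =>
    intro u ψ
    obtain ⟨C, hC0, hC⟩ := exists_integral_norm_le hg u ψ
    refine ⟨C, hC0, fun p q ξ => ?_⟩
    rw [pow_zero, one_mul]
    exact (VectorFourier.norm_fourierIntegral_le_integral_norm _ _ _ _ _).trans (hC p q).2
  | succ n ih =>
    intro u ψ
    obtain ⟨C₁, hC₁0, hC₁⟩ := ih (derivCLM ℂ ℂ u) ψ
    obtain ⟨C₂, hC₂0, hC₂⟩ := ih u (derivCLM ℂ ℂ ψ)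
    refine ⟨C₁ + C₂, by positivity, fun p q ξ => ?_⟩
    obtain ⟨_, _, h0⟩ := exists_integral_norm_le hg u ψ
    obtain ⟨_, _, h1⟩ := exists_integral_norm_le hg (derivCLM ℂ ℂ u) ψ
    obtain ⟨_, _, h2⟩ := exists_integral_norm_le hg u (derivCLM ℂ ℂ ψ)
    have hd : deriv (fun x => u (x + p) * g (timeFreqShift q x ψ)) =
        (fun x => derivCLM ℂ ℂ u (x + p) * g (timeFreqShift q x ψ)) -
        fun x => u (x + p) * g (timeFreqShift q x (derivCLM ℂ ℂ ψ)) := by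
      ext x; exact (hasDerivAt_mul_apply_timeFreqShift u ψ p q x).deriv
    have hF := congrFun (Real.fourier_deriv (h0 p q).1
      (fun x => (hasDerivAt_mul_apply_timeFreqShift u ψ p q x).differentiableAt)
      (by rw [hd]; exact (h1 p q).1.sub (h2 p q).1)) ξ
    have hsub : 𝓕 ((fun x => derivCLM ℂ ℂ u (x + p) * g (timeFreqShift q x ψ)) -
        fun x => u (x + p) * g (timeFreqShift q x (derivCLM ℂ ℂ ψ))) ξ =
        𝓕 (fun x => derivCLM ℂ ℂ u (x + p) * g (timeFreqShift q x ψ)) ξ -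
        𝓕 (fun x => u (x + p) * g (timeFreqShift q x (derivCLM ℂ ℂ ψ))) ξ := by
      simp only [Real.fourier_eq, Pi.sub_apply, smul_sub]
      exact integral_sub ((Real.fourierIntegral_convergent_iff ξ).2 (h1 p q).1)
        ((Real.fourierIntegral_convergent_iff ξ).2 (h2 p q).1)
    rw [hd, hsub] at hF
    have hn : ‖(2 * π * Complex.I * ξ : ℂ)‖ = 2 * π * |ξ| := by
      simp [abs_of_pos pi_pos]
    have hN := congrArg norm hF
    rw [norm_smul, hn] at hN
    set X := ‖𝓕 (fun x => u (x + p) * g (timeFreqShift q x ψ)) ξ‖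
    calc |ξ| ^ (n + 1) * X ≤ |ξ| ^ n * (2 * π * |ξ| * X) := by
          rw [pow_succ, mul_assoc]
          gcongr
          nlinarith [pi_gt_three, abs_nonneg ξ]
      _ ≤ |ξ| ^ n * ‖𝓕 (fun x => derivCLM ℂ ℂ u (x + p) * g (timeFreqShift q x ψ)) ξ‖ +
          |ξ| ^ n * ‖𝓕 (fun x => u (x + p) * g (timeFreqShift q x (derivCLM ℂ ℂ ψ))) ξ‖ := by
          rw [← hN, ← mul_add]
          gcongr
          exact norm_sub_le _ _
      _ ≤ _ := by
          rw [add_mul]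
          exact add_le_add (hC₁ p q ξ) (hC₂ p q ξ)

/-- The response of a time-frequency shifted prototype operator to `g`. -/
noncomputable def atom (g : 𝓢(ℝ, ℂ) →L[ℂ] ℂ) (u ψ : 𝓢(ℝ, ℂ)) (p q x : ℝ) : ℂ :=
  realChar (-q) x * (u (x + p) * g (timeFreqShift q x ψ))

open FourierTransform in
lemma fourier_realChar_mul (q : ℝ) (f : ℝ → ℂ) (ξ : ℝ) :
    𝓕 (fun x => realChar (-q) x * f x) ξ = 𝓕 f (ξ + q) := by
  rw [Real.fourier_eq', Real.fourier_eq']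
  refine integral_congr_ae (Filter.Eventually.of_forall fun x => ?_)
  simp only [realChar, smul_eq_mul, ← mul_assoc, ← Complex.exp_add]
  congr 2
  simp
  ring

open FourierTransform in
/-- An atom is localised around `-p` in time and `-q` in frequency. -/
lemma exists_atom_localised (g : 𝓢(ℝ, ℂ) →L[ℂ] ℂ) :
    ∃ m : ℕ, ∀ (u ψ : 𝓢(ℝ, ℂ)) (n : ℕ), ∃ C, 0 ≤ C ∧ ∀ p q : ℝ,
      Continuous (atom g u ψ p q) ∧ Integrable (atom g u ψ p q) ∧
      (∀ x, |x + p| ^ n * ‖atom g u ψ p q x‖ ≤ C * ((1 + |p|) ^ m * (1 + |q|) ^ m)) ∧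
      ∀ ξ, |ξ + q| ^ n * ‖𝓕 (atom g u ψ p q) ξ‖ ≤ C * ((1 + |p|) ^ m * (1 + |q|) ^ m) := by
  obtain ⟨m, hm⟩ := exists_norm_apply_timeFreqShift_le g
  refine ⟨m, fun u ψ n => ?_⟩
  obtain ⟨C₁, hC₁0, hC₁⟩ := exists_pow_mul_norm_mul_le hm u ψ n
  obtain ⟨C₂, hC₂0, hC₂⟩ := exists_pow_mul_norm_fourier_le hm n u ψ
  obtain ⟨_, _, h0⟩ := exists_integral_norm_le hm u ψ
  refine ⟨C₁ + C₂, by positivity, fun p q => ?_⟩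
  have hc : Continuous (atom g u ψ p q) :=
    (continuous_realChar _).mul (continuous_mul_apply_timeFreqShift u ψ p q)
  have hA : 0 ≤ (1 + |p|) ^ m * (1 + |q|) ^ m := by positivity
  have hn : ∀ x, ‖atom g u ψ p q x‖ = ‖u (x + p) * g (timeFreqShift q x ψ)‖ := fun x => by
    rw [atom, norm_mul, norm_realChar, one_mul]
  refine ⟨hc, (h0 p q).1.norm.mono' hc.aestronglyMeasurable
    (Filter.Eventually.of_forall fun x => (hn x).le), fun x => ?_, fun ξ => ?_⟩
  · rw [hn]
    calc _ ≤ (1 + |x + p|) ^ n * ‖u (x + p) * g (timeFreqShift q x ψ)‖ := by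
          gcongr; linarith
      _ ≤ C₁ * ((1 + |p|) ^ m * (1 + |q|) ^ m) := hC₁ p q x
      _ ≤ _ := by gcongr; linarith
  · have : 𝓕 (atom g u ψ p q) ξ = 𝓕 (fun x => u (x + p) * g (timeFreqShift q x ψ)) (ξ + q) :=
      fourier_realChar_mul q _ ξ
    rw [this]
    refine (hC₂ p q (ξ + q)).trans ?_
    gcongr; linarith

end Atoms

open FourierTransform in
lemma fourier_comp_mul_left (f : ℝ → ℂ) {a : ℝ} (ha : 0 < a) (ξ : ℝ) :
    𝓕 (fun x => f (a * x)) ξ = (a⁻¹ : ℝ) * 𝓕 f (ξ / a) := by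
  rw [Real.fourier_real_eq, Real.fourier_real_eq]
  have h := Measure.integral_comp_mul_left
    (fun x : ℝ => Real.fourierChar (-(x * (ξ / a))) • f x) a
  rw [abs_of_pos (inv_pos.2 ha)] at h
  rw [← Complex.real_smul, ← h]
  refine integral_congr_ae (Filter.Eventually.of_forall fun x => ?_)
  have : a * x * (ξ / a) = x * ξ := by field_simp
  simp only [this]

lemma summable_one_div_int_sq : Summable fun n : ℤ => 1 / (n : ℝ) ^ 2 :=
  Real.summable_one_div_int_pow.2 one_lt_two

open FourierTransform in
/-- A function that is small outside a time-frequency square, and whose Fourier transform vanishes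
at all sampling points of the square, is small everywhere. -/
lemma one_add_sq_mul_norm_le_of_fourier_eq_zero {f : ℝ → ℂ} (hf : Continuous f) {R E : ℝ}
    (hR : 1 ≤ R) (hE : 0 ≤ E) (h1 : ∀ x, R ≤ |x| → x ^ 2 * ‖f x‖ ≤ E)
    (h2 : ∀ ξ, R ≤ |ξ| → ξ ^ 2 * ‖𝓕 f ξ‖ ≤ E)
    (h3 : ∀ n : ℤ, |(n : ℝ)| ≤ 2 * R ^ 2 → 𝓕 f (n / (2 * R)) = 0) (x : ℝ) :
    (1 + x ^ 2) * ‖f x‖ ≤ (6 * ∑' n : ℤ, 1 / (n : ℝ) ^ 2 + 2) * (E * R ^ 3) := by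
  set S := ∑' n : ℤ, 1 / (n : ℝ) ^ 2 with hS
  have hR0 : 0 < R := by linarith
  have hS0 : 0 ≤ S := tsum_nonneg fun n => by positivity
  rcases le_total R |x| with hx | hx
  · have hx1 : 1 ≤ x ^ 2 := by rw [← sq_abs]; nlinarith
    have hR3 : 1 ≤ R ^ 3 := one_le_pow₀ hR
    calc (1 + x ^ 2) * ‖f x‖ ≤ (2 * x ^ 2) * ‖f x‖ := by gcongr; linarith
      _ = 2 * (x ^ 2 * ‖f x‖) := by ring
      _ ≤ 2 * (E * 1) := by rw [mul_one]; gcongr; exact h1 x hx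
      _ ≤ (6 * S + 2) * (E * R ^ 3) := by gcongr; linarith
  set F : ℝ → ℂ := fun y => f (2 * R * y) with hF
  have hFc : Continuous F := hf.comp (continuous_const.mul continuous_id)
  have hFF : ∀ n : ℤ, ‖𝓕 F n‖ ≤ 2 * R * E * (1 / (n : ℝ) ^ 2) := by
    intro n
    rw [hF, fourier_comp_mul_left f (by positivity)]
    rcases le_or_gt |(n : ℝ)| (2 * R ^ 2) with hn | hn
    · rw [h3 n hn]; simp; positivity
    · have hn' : R ≤ |(n : ℝ) / (2 * R)| := by
        rw [abs_div, abs_of_pos (by positivity : 0 < 2 * R), le_div_iff₀ (by positivity)]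
        nlinarith
      have hn0 : (n : ℝ) ≠ 0 := by
        intro h0; rw [h0, abs_zero] at hn; nlinarith
      have := h2 _ hn'
      have hsq : 0 < (n : ℝ) ^ 2 := by positivity
      rw [norm_mul, Complex.norm_real, Real.norm_eq_abs, abs_of_pos (by positivity)]
      rw [mul_one_div, le_div_iff₀ hsq]
      calc _ = 2 * R * (((n : ℝ) / (2 * R)) ^ 2 * ‖𝓕 f (n / (2 * R))‖) := by field_simp
        _ ≤ _ := by gcongr
  have hsum : Summable fun n : ℤ => 2 * R * E * (1 / (n : ℝ) ^ 2) :=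
    summable_one_div_int_sq.mul_left _
  have hFO : F =O[Filter.cocompact ℝ] fun x : ℝ => |x| ^ (-2 : ℝ) := by
    refine Asymptotics.IsBigO.of_bound E ?_
    filter_upwards [(isCompact_closedBall (0 : ℝ) 1).compl_mem_cocompact] with y hy
    have hy1 : 1 < |y| := by simpa using hy
    have hRy : R ≤ |2 * R * y| := by
      rw [abs_mul, abs_of_pos (by positivity : 0 < 2 * R)]; nlinarith
    have := h1 _ hRy
    have e : |y| ^ (-2 : ℝ) = (y ^ 2)⁻¹ := by
      rw [Real.rpow_neg (abs_nonneg _)]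
      norm_cast
      rw [sq_abs]
    have hysq : 0 < y ^ 2 := by rw [← sq_abs]; positivity
    rw [e, norm_inv, Real.norm_eq_abs, abs_of_pos hysq, ← div_eq_mul_inv, le_div_iff₀ hysq]
    refine le_trans ?_ this
    rw [mul_comm, mul_pow]
    gcongr
    exact le_mul_of_one_le_left hysq.le (by nlinarith)
  have hP := Real.tsum_eq_tsum_fourier_of_rpow_decay_of_summable hFc one_lt_two hFO
    (Summable.of_norm_bounded hsum hFF) (x / (2 * R))
  have hper : ‖∑' n : ℤ, F (x / (2 * R) + n)‖ ≤ 2 * R * E * S := by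
    rw [hP, hS, ← tsum_mul_left]
    refine tsum_of_norm_bounded hsum.hasSum fun n => ?_
    rw [norm_mul, fourier_apply, Circle.norm_coe, mul_one]
    exact hFF n
  have htail : ∀ n : ℤ, ‖if n = 0 then 0 else F (x / (2 * R) + n)‖ ≤ E * (1 / (n : ℝ) ^ 2) := by
    intro n
    split_ifs with hn
    · simp [hn]
    · have hn1 : (1 : ℝ) ≤ |(n : ℝ)| := by exact_mod_cast Int.one_le_abs hn
      have e : 2 * R * (x / (2 * R) + n) = x + 2 * R * n := by field_simp
      have hge : R * |(n : ℝ)| ≤ |x + 2 * R * n| := by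
        have h4 := abs_sub_abs_le_abs_sub (2 * R * n) (-x)
        rw [abs_neg, abs_mul, abs_of_pos (by positivity : 0 < 2 * R), sub_neg_eq_add,
          add_comm] at h4
        nlinarith
      have h5 := h1 (x + 2 * R * n) (le_trans (by nlinarith) hge)
      have hnsq : 0 < (n : ℝ) ^ 2 := by rw [← sq_abs]; positivity
      simp only [hF, e]
      rw [mul_one_div, le_div_iff₀ hnsq]
      refine le_trans ?_ h5
      rw [mul_comm]
      refine mul_le_mul_of_nonneg_right (sq_le_sq.2 (le_trans ?_ hge)) (norm_nonneg _)
      nlinarith [abs_nonneg (n : ℝ)]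
  have hsum' : Summable fun n : ℤ => E * (1 / (n : ℝ) ^ 2) := summable_one_div_int_sq.mul_left _
  have hsF : Summable fun n : ℤ => F (x / (2 * R) + n) := by
    have := Summable.of_norm_bounded hsum' htail
    refine (summable_congr_cofinite ?_).1 this
    filter_upwards [(Set.finite_singleton (0 : ℤ)).compl_mem_cofinite] with n hn
    rw [if_neg (by simpa using hn)]
  have hsplit := hsF.tsum_eq_add_tsum_ite 0
  have hx0 : F (x / (2 * R) + (0 : ℤ)) = f x := by
    simp only [hF]; congr 1; push_cast; field_simp; ring
  rw [hx0] at hsplit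
  have htail' : ‖∑' n : ℤ, if n = 0 then 0 else F (x / (2 * R) + n)‖ ≤ E * S := by
    rw [hS, ← tsum_mul_left]
    exact tsum_of_norm_bounded hsum'.hasSum htail
  have hfx : ‖f x‖ ≤ 3 * R * E * S := by
    have : f x = (∑' n : ℤ, F (x / (2 * R) + n)) -
        ∑' n : ℤ, if n = 0 then 0 else F (x / (2 * R) + n) := by rw [hsplit]; ring
    rw [this]
    refine (norm_sub_le _ _).trans ((add_le_add hper htail').trans ?_)
    have : 0 ≤ E * S := by positivity
    nlinarith
  have hx2 : 1 + x ^ 2 ≤ 2 * R ^ 2 := by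
    have : x ^ 2 ≤ R ^ 2 := by rw [← sq_abs]; gcongr
    nlinarith
  calc (1 + x ^ 2) * ‖f x‖ ≤ (2 * R ^ 2) * (3 * R * E * S) := by gcongr
    _ = 6 * S * (E * R ^ 3) := by ring
    _ ≤ _ := by gcongr; linarith

lemma eLpNorm_two_le_of_one_add_sq_mul_norm_le {f : ℝ → ℂ} {E : ℝ}
    (h : ∀ x, (1 + x ^ 2) * ‖f x‖ ≤ E) :
    eLpNorm f 2 volume ≤ ENNReal.ofReal E * eLpNorm (fun x : ℝ => (1 + x ^ 2)⁻¹) 2 volume := by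
  refine eLpNorm_le_mul_eLpNorm_of_ae_le_mul (Filter.Eventually.of_forall fun x => ?_) 2
  have hx : 0 < 1 + x ^ 2 := by positivity
  rw [norm_inv, Real.norm_eq_abs, abs_of_pos hx, ← div_eq_mul_inv, le_div_iff₀ hx, mul_comm]
  exact h x

lemma eLpNorm_inv_one_add_sq_lt_top :
    eLpNorm (fun x : ℝ => (1 + x ^ 2)⁻¹) 2 volume < ⊤ := by
  have hc : Continuous fun x : ℝ => (1 + x ^ 2)⁻¹ :=
    Continuous.inv₀ (by fun_prop) fun x => by positivity
  refine ((memLp_two_iff_integrable_sq hc.aestronglyMeasurable).2 ?_).2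
  refine integrable_inv_one_add_sq.mono' (hc.pow 2).aestronglyMeasurable
    (Filter.Eventually.of_forall fun x => ?_)
  have hx : 0 < 1 + x ^ 2 := by positivity
  have : (1 + x ^ 2)⁻¹ ≤ 1 := inv_le_one_of_one_le₀ (by nlinarith [sq_nonneg x])
  rw [Real.norm_eq_abs, abs_of_nonneg (by positivity), sq]
  exact mul_le_of_le_one_left (by positivity) this

/-- An open planar set of measure greater than one contains disjoint closed grid squares of total
area greater than one. -/
lemma exists_grid_squares {M : Set (ℝ × ℝ)} (hM : IsOpen M) (hμ : 1 < volume M) :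
    ∃ r : ℝ, 0 < r ∧ ∃ T : Finset (ℤ × ℤ), 1 < T.card * (2 * r) ^ 2 ∧ ∀ j ∈ T,
      Metric.closedBall ((2 * j.1 + 1) * r) r ×ˢ Metric.closedBall ((2 * j.2 + 1) * r) r ⊆ M := by
  classical
  obtain ⟨K, hKM, hK, hKμ⟩ := hM.exists_lt_isCompact hμ
  obtain ⟨s, hs, hsM⟩ := hK.exists_cthickening_subset_open hM hKM
  set cell : ℤ → Set ℝ := fun i => Set.Ico (s * i) (s * i + s) with hcell
  have hmem : ∀ t : ℝ, t ∈ cell ⌊t / s⌋ := fun t => by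
    have h1 := Int.floor_le (t / s)
    have h2 := Int.lt_floor_add_one (t / s)
    rw [le_div_iff₀ hs] at h1
    rw [div_lt_iff₀ hs] at h2
    constructor <;> nlinarith
  obtain ⟨ρ, hρ⟩ := hK.isBounded.subset_closedBall (0 : ℝ × ℝ)
  set I := Finset.Icc ⌊-ρ / s⌋ ⌊ρ / s⌋
  set T := (I ×ˢ I).filter fun j => (cell j.1 ×ˢ cell j.2 ∩ K).Nonempty with hT
  have hcover : K ⊆ ⋃ j ∈ T, cell j.1 ×ˢ cell j.2 := by
    intro z hz
    have hzρ := hρ hz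
    rw [mem_closedBall_zero_iff, Prod.norm_def, max_le_iff, Real.norm_eq_abs, Real.norm_eq_abs,
      abs_le, abs_le] at hzρ
    refine Set.mem_biUnion (x := (⌊z.1 / s⌋, ⌊z.2 / s⌋)) ?_ ⟨hmem _, hmem _⟩
    simp only [hT, Finset.coe_filter, Finset.mem_product, I, Finset.mem_Icc, Set.mem_ofPred_eq]
    refine ⟨⟨⟨?_, ?_⟩, ?_, ?_⟩, z, ⟨hmem _, hmem _⟩, hz⟩ <;> gcongr <;> tauto
  refine ⟨s / 2, by positivity, T, ?_, fun j hj => ?_⟩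
  · have h1 : volume K ≤ ∑ j ∈ T, volume (cell j.1 ×ˢ cell j.2) :=
      (measure_mono hcover).trans (measure_biUnion_finset_le _ _)
    have h2 : ∀ j : ℤ × ℤ, volume (cell j.1 ×ˢ cell j.2) = ENNReal.ofReal (s ^ 2) := fun j => by
      rw [Measure.volume_eq_prod, Measure.prod_prod, Real.volume_Ico, Real.volume_Ico,
        ← ENNReal.ofReal_mul (by linarith)]
      congr 1; ring
    simp only [h2, Finset.sum_const, nsmul_eq_mul] at h1
    have h3 := hKμ.trans_le h1
    rw [← ENNReal.ofReal_natCast, ← ENNReal.ofReal_mul (by positivity), ENNReal.one_lt_ofReal] at h3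
    rwa [mul_div_cancel₀ _ two_ne_zero]
  · obtain ⟨z, hz, hzK⟩ := (Finset.mem_filter.1 hj).2
    refine Set.Subset.trans (fun w hw => ?_) hsM
    refine Metric.mem_cthickening_of_dist_le w z s K hzK ?_
    have key : ∀ (i : ℤ) (t t' : ℝ), t ∈ Metric.closedBall ((2 * i + 1) * (s / 2)) (s / 2) →
        t' ∈ cell i → dist t t' ≤ s := by
      intro i t t' ht ht'
      rw [Metric.mem_closedBall, Real.dist_eq, abs_le] at ht
      rw [Real.dist_eq, abs_le]
      obtain ⟨h1, h2⟩ := ht'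
      constructor <;> nlinarith
    rw [Prod.dist_eq, max_le_iff]
    exact ⟨key _ _ _ hw.1 hz.1, key _ _ _ hw.2 hz.2⟩

lemma setIntegral_realChar {a : ℝ} (ha : 0 < a) (x : ℝ) (k : ℤ) :
    ∫ t in Metric.closedBall x (a / 2), realChar (k / a) t = if k = 0 then (a : ℂ) else 0 := by
  rw [Real.closedBall_eq_Icc, integral_Icc_eq_integral_Ioc,
    ← intervalIntegral.integral_of_le (by linarith)]
  split_ifs with hk
  · simp [hk, realChar]
  · have hc : (2 * π * Complex.I * (k / a : ℝ) : ℂ) ≠ 0 := by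
      have := pi_ne_zero
      push_cast
      simp [hk, ha.ne', this]
    have h := integral_exp_mul_complex (a := x - a / 2) (b := x + a / 2) hc
    unfold realChar
    rw [h]
    have e : (2 * π * Complex.I * (k / a : ℝ) : ℂ) * (x + a / 2 : ℝ) =
        (2 * π * Complex.I * (k / a : ℝ) : ℂ) * (x - a / 2 : ℝ) + k * (2 * π * Complex.I) := by
      have : (a : ℂ) ≠ 0 := by exact_mod_cast ha.ne'
      push_cast; field_simp; ring
    rw [e, Complex.exp_add, Complex.exp_int_mul_two_pi_mul_I, mul_one, sub_self, zero_div]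

/-- A translate of a smooth bump function, as a Schwartz function. -/
noncomputable def bumpSchwartz (β : ContDiffBump (0 : ℝ)) (c : ℝ) : 𝓢(ℝ, ℂ) :=
  compSubConstCLM ℂ c (HasCompactSupport.toSchwartzMap (f := fun t => (β t : ℂ))
    (β.hasCompactSupport.comp_left Complex.ofReal_zero)
    (Complex.ofRealCLM.contDiff.comp β.contDiff))

lemma bumpSchwartz_apply (β : ContDiffBump (0 : ℝ)) (c t : ℝ) :
    bumpSchwartz β c t = (β (t - c) : ℂ) := by
  rw [bumpSchwartz, compSubConstCLM_apply]; rfl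

/-- A modulated bump in the `j`-th interval of a grid of width `2 * β.rOut`. The frequency is an
integer multiple of the inverse length of the interval on which the bump is one. -/
noncomputable def gridBump (β : ContDiffBump (0 : ℝ)) (j k : ℤ) (t : ℝ) : ℂ :=
  bumpSchwartz β ((2 * j + 1) * β.rOut) t * realChar (k / (2 * β.rIn)) t

section GridBump

variable (β : ContDiffBump (0 : ℝ))

lemma contDiff_gridBump (j k : ℤ) {n : ℕ∞} : ContDiff ℝ n (gridBump β j k) :=
  ((bumpSchwartz β _).smooth n).mul (contDiff_realChar _)

lemma continuous_gridBump (j k : ℤ) : Continuous (gridBump β j k) :=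
  (contDiff_gridBump β j k (n := 0)).continuous

lemma gridBump_eq_zero {j : ℤ} {t : ℝ}
    (ht : t ∉ Metric.closedBall ((2 * j + 1) * β.rOut) β.rOut) (k : ℤ) : gridBump β j k t = 0 := by
  rw [gridBump, bumpSchwartz_apply, β.zero_of_le_dist, Complex.ofReal_zero, zero_mul]
  rw [Metric.mem_closedBall, not_le, Real.dist_eq] at ht
  simpa using ht.le

lemma integrable_gridBump (j k : ℤ) : Integrable (gridBump β j k) :=
  (continuous_gridBump β j k).integrable_of_hasCompactSupport
    (HasCompactSupport.of_support_subset_isCompact (isCompact_closedBall ((2 * j + 1) * β.rOut) β.rOut)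
      fun t ht => by
        by_contra h
        exact ht (gridBump_eq_zero β h k))

lemma setIntegral_gridBump_mul (j j₀ k k₀ : ℤ) :
    ∫ t in Metric.closedBall ((2 * j₀ + 1) * β.rOut) β.rIn,
        gridBump β j k t * realChar (-(k₀ / (2 * β.rIn))) t =
      if j = j₀ ∧ k = k₀ then ((2 * β.rIn : ℝ) : ℂ) else 0 := by
  have hlt := β.rIn_lt_rOut
  have hin := β.rIn_pos
  by_cases hj : j = j₀
  · subst hj
    have h1 : ∀ t ∈ Metric.closedBall ((2 * j + 1) * β.rOut) β.rIn,
        gridBump β j k t * realChar (-(k₀ / (2 * β.rIn))) t =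
          realChar ((k - k₀ : ℤ) / (2 * β.rIn)) t := by
      intro t ht
      rw [gridBump, bumpSchwartz_apply, β.one_of_mem_closedBall, Complex.ofReal_one, one_mul,
        ← realChar_add_left]
      · congr 1; push_cast; ring
      · rw [Metric.mem_closedBall, Real.dist_eq] at ht
        simpa using ht
    rw [setIntegral_congr_fun measurableSet_closedBall h1]
    have h2 := setIntegral_realChar (a := 2 * β.rIn) (by positivity) ((2 * j + 1) * β.rOut) (k - k₀)
    rw [mul_div_cancel_left₀ _ two_ne_zero] at h2
    rw [h2]
    simp [sub_eq_zero]
  · rw [if_neg (fun h => hj h.1)]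
    refine setIntegral_eq_zero_of_forall_eq_zero fun t ht => ?_
    rw [gridBump_eq_zero, zero_mul]
    intro ht'
    rw [Metric.mem_closedBall, Real.dist_eq, abs_le] at ht ht'
    have h3 : |((j - j₀ : ℤ) : ℝ)| < 1 := by
      rw [abs_lt]; push_cast
      constructor <;> nlinarith
    have h4 : |j - j₀| < 1 := by exact_mod_cast h3
    exact hj (sub_eq_zero.1 (Int.abs_lt_one_iff.1 h4))

end GridBump

/-- Index set of the grid atoms: a grid square together with two frequencies of modulus at most
`N`. -/
abbrev GridIndex (T : Finset (ℤ × ℤ)) (N : ℕ) : Type :=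
  ↥T × ↥(Finset.Icc (-(N : ℤ)) N) × ↥(Finset.Icc (-(N : ℤ)) N)

lemma card_gridIndex (T : Finset (ℤ × ℤ)) (N : ℕ) :
    Fintype.card (GridIndex T N) = T.card * (2 * N + 1) ^ 2 := by
  have h : ((N : ℤ) + 1 - -(N : ℤ)).toNat = 2 * N + 1 := by omega
  simp only [GridIndex, Fintype.card_prod, Fintype.card_coe, Int.card_Icc, h]
  ring

section GridSum

variable {T : Finset (ℤ × ℤ)} {N : ℕ} (β : ContDiffBump (0 : ℝ)) (c : GridIndex T N → ℂ)

/-- A linear combination of tensor products of modulated bumps, supported in the squares of the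
grid indexed by `T`. -/
noncomputable def gridSum (p : ℝ × ℝ) : ℂ :=
  ∑ i, c i * (gridBump β i.1.1.1 i.2.1 p.1 * gridBump β i.1.1.2 i.2.2 p.2)

lemma contDiff_gridSum : ContDiff ℝ (⊤ : ℕ∞) (gridSum β c) :=
  ContDiff.sum fun _ _ => contDiff_const.mul
    (((contDiff_gridBump β _ _).comp contDiff_fst).mul
      ((contDiff_gridBump β _ _).comp contDiff_snd))

lemma tsupport_gridSum_subset :
    tsupport (gridSum β c) ⊆ ⋃ j ∈ T, Metric.closedBall ((2 * j.1 + 1) * β.rOut) β.rOut ×ˢ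
      Metric.closedBall ((2 * j.2 + 1) * β.rOut) β.rOut := by
  refine closure_minimal (fun p hp => ?_) (T.finite_toSet.isClosed_biUnion fun _ _ =>
    Metric.isClosed_closedBall.prod Metric.isClosed_closedBall)
  by_contra h
  refine hp (Finset.sum_eq_zero fun i _ => ?_)
  simp only [Set.mem_iUnion, not_exists, Set.mem_prod, not_and_or] at h
  rcases h i.1.1 i.1.2 with h | h
  · rw [gridBump_eq_zero β h, zero_mul, mul_zero]
  · rw [gridBump_eq_zero β h, mul_zero, mul_zero]

lemma hasCompactSupport_gridSum : HasCompactSupport (gridSum β c) :=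
  (T.finite_toSet.isCompact_biUnion fun _ _ =>
    (isCompact_closedBall _ _).prod (isCompact_closedBall _ _)).of_isClosed_subset
    (isClosed_tsupport _) (tsupport_gridSum_subset β c)

lemma setIntegral_gridSum_mul (i : GridIndex T N) :
    ∫ p in Metric.closedBall ((2 * i.1.1.1 + 1) * β.rOut) β.rIn ×ˢ
        Metric.closedBall ((2 * i.1.1.2 + 1) * β.rOut) β.rIn,
      gridSum β c p * (realChar (-((i.2.1 : ℤ) / (2 * β.rIn))) p.1 *
        realChar (-((i.2.2 : ℤ) / (2 * β.rIn))) p.2) = c i * ((2 * β.rIn : ℝ) : ℂ) ^ 2 := by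
  have hcont : ∀ j k k₀ : ℤ, Continuous fun t =>
      gridBump β j k t * realChar (-(k₀ / (2 * β.rIn))) t := fun j k k₀ =>
    (continuous_gridBump β j k).mul (continuous_realChar _)
  have e : ∀ p : ℝ × ℝ, gridSum β c p * (realChar (-((i.2.1 : ℤ) / (2 * β.rIn))) p.1 *
        realChar (-((i.2.2 : ℤ) / (2 * β.rIn))) p.2) = ∑ i', c i' *
      ((gridBump β i'.1.1.1 i'.2.1 p.1 * realChar (-((i.2.1 : ℤ) / (2 * β.rIn))) p.1) *
       (gridBump β i'.1.1.2 i'.2.2 p.2 * realChar (-((i.2.2 : ℤ) / (2 * β.rIn))) p.2)) := by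
    intro p
    rw [gridSum, Finset.sum_mul]
    exact Finset.sum_congr rfl fun _ _ => by ring
  have hprod : ∀ i' : GridIndex T N, ∫ p in Metric.closedBall ((2 * i.1.1.1 + 1) * β.rOut) β.rIn ×ˢ
        Metric.closedBall ((2 * i.1.1.2 + 1) * β.rOut) β.rIn,
      (gridBump β i'.1.1.1 i'.2.1 p.1 * realChar (-((i.2.1 : ℤ) / (2 * β.rIn))) p.1) *
       (gridBump β i'.1.1.2 i'.2.2 p.2 * realChar (-((i.2.2 : ℤ) / (2 * β.rIn))) p.2) =
      (if i'.1.1.1 = i.1.1.1 ∧ (i'.2.1 : ℤ) = i.2.1 then ((2 * β.rIn : ℝ) : ℂ) else 0) *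
      (if i'.1.1.2 = i.1.1.2 ∧ (i'.2.2 : ℤ) = i.2.2 then ((2 * β.rIn : ℝ) : ℂ) else 0) := by
    intro i'
    rw [← setIntegral_gridBump_mul, ← setIntegral_gridBump_mul]
    exact setIntegral_prod_mul
      (fun t => gridBump β i'.1.1.1 i'.2.1 t * realChar (-((i.2.1 : ℤ) / (2 * β.rIn))) t)
      (fun t => gridBump β i'.1.1.2 i'.2.2 t * realChar (-((i.2.2 : ℤ) / (2 * β.rIn))) t) _ _
  simp_rw [e]
  rw [integral_finsetSum]
  · simp_rw [integral_const_mul]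
    rw [Finset.sum_eq_single i]
    · rw [hprod]
      simp [sq]
    · intro i' _ hi'
      rw [hprod]
      by_contra hne
      simp only [mul_ite, ite_mul, zero_mul, mul_zero] at hne
      split_ifs at hne with h1 h2
      · exact hi' (Prod.ext (Subtype.ext (Prod.ext h2.1 h1.1))
          (Prod.ext (Subtype.ext h2.2) (Subtype.ext h1.2)))
      all_goals exact hne rfl
    · simp
  · intro i' _
    refine ContinuousOn.integrableOn_compact
      ((isCompact_closedBall _ _).prod (isCompact_closedBall _ _)) (Continuous.continuousOn ?_)
    exact continuous_const.mul (((hcont _ _ _).comp continuous_fst).mul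
      ((hcont _ _ _).comp continuous_snd))

lemma norm_mul_le_eLpNorm_gridSum :
    ENNReal.ofReal (‖c‖ * (2 * β.rIn)) ≤ eLpNorm (gridSum β c) 2 volume := by
  have ha : 0 < 2 * β.rIn := by have := β.rIn_pos; positivity
  have key : ∀ i, ‖c i‖ₑ * ENNReal.ofReal (2 * β.rIn) ≤ eLpNorm (gridSum β c) 2 volume := by
    intro i
    set Q := Metric.closedBall ((2 * i.1.1.1 + 1) * β.rOut) β.rIn ×ˢ
        Metric.closedBall ((2 * i.1.1.2 + 1) * β.rOut) β.rIn with hQ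
    have hμQ : volume Q = ENNReal.ofReal (2 * β.rIn) ^ 2 := by
      rw [hQ, Measure.volume_eq_prod, Measure.prod_prod, Real.volume_closedBall,
        Real.volume_closedBall, sq]
    have h1 := enorm_integral_le_lintegral_enorm (μ := volume.restrict Q) fun p : ℝ × ℝ =>
      gridSum β c p * (realChar (-((i.2.1 : ℤ) / (2 * β.rIn))) p.1 *
        realChar (-((i.2.2 : ℤ) / (2 * β.rIn))) p.2)
    have h2 : ∀ q t : ℝ, ‖realChar q t‖ₑ = 1 := fun q t => by
      rw [← ofReal_norm, norm_realChar, ENNReal.ofReal_one]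
    rw [setIntegral_gridSum_mul β c i] at h1
    simp only [enorm_mul, h2, mul_one, enorm_pow] at h1
    rw [← eLpNorm_one_eq_lintegral_enorm] at h1
    have h3 := h1.trans (eLpNorm_le_eLpNorm_mul_rpow_measure_univ (p := 1) (q := 2) (by norm_num)
      (contDiff_gridSum β c).continuous.aestronglyMeasurable)
    have h4 : ‖((2 * β.rIn : ℝ) : ℂ)‖ₑ = ENNReal.ofReal (2 * β.rIn) := by
      rw [← ofReal_norm, Complex.norm_real, Real.norm_of_nonneg ha.le]
    rw [h4, Measure.restrict_apply_univ, hμQ] at h3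
    have h5 : (ENNReal.ofReal (2 * β.rIn) ^ 2) ^
        (1 / (1 : ENNReal).toReal - 1 / (2 : ENNReal).toReal) = ENNReal.ofReal (2 * β.rIn) := by
      rw [← ENNReal.rpow_natCast, ← ENNReal.rpow_mul]
      norm_num
    rw [h5, sq, ← mul_assoc] at h3
    exact ((ENNReal.mul_le_mul_iff_left (ENNReal.ofReal_pos.2 ha).ne' ENNReal.ofReal_ne_top).1
      h3).trans (eLpNorm_mono_measure _ Measure.restrict_le_self)
  rw [ENNReal.ofReal_mul (norm_nonneg _)]
  rcases isEmpty_or_nonempty (GridIndex T N) with h | h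
  · have : ‖c‖ = 0 := by rw [norm_eq_zero]; exact Subsingleton.elim _ _
    simp [this]
  · obtain ⟨i, hi⟩ := Finite.exists_max fun i => ‖c i‖
    have : ‖c‖ = ‖c i‖ := le_antisymm ((pi_norm_le_iff_of_nonneg (norm_nonneg _)).2 hi)
      (norm_le_pi_norm c i)
    rw [this, ofReal_norm]
    exact key i

lemma gridSum_ne_zero (hc : c ≠ 0) : gridSum β c ≠ 0 := by
  intro h
  have h1 := norm_mul_le_eLpNorm_gridSum β c
  rw [h, eLpNorm_zero, nonpos_iff_eq_zero, ENNReal.ofReal_eq_zero] at h1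
  have := β.rIn_pos
  have := norm_pos_iff.2 hc
  have : 0 < ‖c‖ * (2 * β.rIn) := by positivity
  linarith

end GridSum

open FourierTransform in
/-- The frequency profile of the atoms attached to the `j`-th interval. -/
noncomputable def freqWindow (β : ContDiffBump (0 : ℝ)) (j : ℤ) : 𝓢(ℝ, ℂ) :=
  𝓕⁻ (bumpSchwartz β ((2 * j + 1) * β.rOut))

/-- The time profile of the atoms attached to the `j`-th interval. -/
noncomputable def timeWindow (β : ContDiffBump (0 : ℝ)) (j : ℤ) : 𝓢(ℝ, ℂ) :=
  bumpSchwartz β (-((2 * j + 1) * β.rOut))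

lemma realChar_comm (x y : ℝ) : realChar x y = realChar y x := by
  rw [realChar, realChar]; congr 1; ring

lemma integral_gridBump_mul_realChar (β : ContDiffBump (0 : ℝ)) (j k : ℤ) (x : ℝ) :
    ∫ ν, gridBump β j k ν * realChar x ν = freqWindow β j (x + k / (2 * β.rIn)) := by
  rw [freqWindow, SchwartzMap.fourierInv_coe, Real.fourierInv_eq']
  refine integral_congr_ae (Filter.Eventually.of_forall fun ν => ?_)
  simp only [gridBump, smul_eq_mul]
  rw [mul_assoc, ← realChar_add_left, mul_comm]
  congr 1
  rw [realChar]
  congr 1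
  simp only [RCLike.inner_apply, conj_trivial]
  push_cast
  ring

lemma gridBump_sub (β : ContDiffBump (0 : ℝ)) (j k : ℤ) (x y : ℝ) :
    gridBump β j k (x - y) = realChar (k / (2 * β.rIn)) x *
      timeFreqShift (-(k / (2 * β.rIn))) x (timeWindow β j) y := by
  rw [gridBump, timeFreqShift_apply, timeWindow, bumpSchwartz_apply, bumpSchwartz_apply,
    sub_eq_add_neg x y, realChar_add_right, ← β.neg]
  have h : realChar (k / (2 * β.rIn)) (-y) = realChar (-(k / (2 * β.rIn))) y := by
    rw [realChar, realChar]; congr 1; push_cast; ring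
  rw [h]
  have : -(x + -y - (2 * (j : ℝ) + 1) * β.rOut) = y - x - -((2 * j + 1) * β.rOut) := by ring
  rw [this]
  ring

/-- The atom of the response that belongs to a grid index. -/
noncomputable def gridAtom {T : Finset (ℤ × ℤ)} {N : ℕ} (g : 𝓢(ℝ, ℂ) →L[ℂ] ℂ)
    (β : ContDiffBump (0 : ℝ)) (i : GridIndex T N) : ℝ → ℂ :=
  atom g (freqWindow β i.1.1.2) (timeWindow β i.1.1.1) ((i.2.2 : ℤ) / (2 * β.rIn))
    (-((i.2.1 : ℤ) / (2 * β.rIn)))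

lemma apply_eq_sum_gridAtom {T : Finset (ℤ × ℤ)} {N : ℕ} (g : 𝓢(ℝ, ℂ) →L[ℂ] ℂ)
    (β : ContDiffBump (0 : ℝ)) (c : GridIndex T N → ℂ) (φ : ℝ → 𝓢(ℝ, ℂ))
    (hφ : ∀ x y : ℝ, φ x y =
      ∫ ν : ℝ, gridSum β c (x - y, ν) * Complex.exp (2 * π * Complex.I * ν * x)) (x : ℝ) :
    g (φ x) = ∑ i, c i * gridAtom g β i x := by
  have h : φ x = ∑ i : GridIndex T N, (c i * (realChar ((i.2.1 : ℤ) / (2 * β.rIn)) x *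
      freqWindow β i.1.1.2 (x + (i.2.2 : ℤ) / (2 * β.rIn)))) •
        timeFreqShift (-((i.2.1 : ℤ) / (2 * β.rIn))) x (timeWindow β i.1.1.1) := by
    ext y
    have hint : ∀ i : GridIndex T N, Integrable fun ν => c i * gridBump β i.1.1.1 i.2.1 (x - y) *
        (gridBump β i.1.1.2 i.2.2 ν * realChar x ν) := fun i =>
      ((integrable_gridBump β i.1.1.2 i.2.2).mul_bdd (c := 1)
        (continuous_realChar x).aestronglyMeasurable
        (Filter.Eventually.of_forall fun ν => (norm_realChar x ν).le)).const_mul _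
    have hsum : ∀ ν : ℝ, gridSum β c (x - y, ν) * Complex.exp (2 * π * Complex.I * ν * x) =
        ∑ i : GridIndex T N, c i * gridBump β i.1.1.1 i.2.1 (x - y) *
        (gridBump β i.1.1.2 i.2.2 ν * realChar x ν) := by
      intro ν
      rw [gridSum, Finset.sum_mul, realChar_comm, realChar]
      exact Finset.sum_congr rfl fun _ _ => by ring
    rw [hφ]
    simp_rw [hsum]
    rw [integral_finsetSum _ fun i _ => hint i, sum_apply]
    refine Finset.sum_congr rfl fun i _ => ?_
    rw [integral_const_mul, integral_gridBump_mul_realChar, gridBump_sub, smul_apply,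
      smul_eq_mul]
    ring
  rw [h, map_sum]
  refine Finset.sum_congr rfl fun i _ => ?_
  rw [map_smul, smul_eq_mul, gridAtom, atom, neg_neg]
  ring

lemma sq_mul_norm_sum_mul_le {ι : Type*} [Fintype ι] (c : ι → ℂ) {F : ι → ℂ} {p : ι → ℝ}
    {x R θ B : ℝ} {k : ℕ} (hθ : 0 < θ) (hR : 0 < R) (hp : ∀ i, |p i| ≤ (1 - θ) * R)
    (hx : R ≤ |x|) (hF : ∀ i, |x + p i| ^ (k + 2) * ‖F i‖ ≤ B) :
    x ^ 2 * ‖∑ i, c i * F i‖ ≤ Fintype.card ι * (‖c‖ * (B / (θ ^ (k + 2) * R ^ k))) := by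
  have key : ∀ i, x ^ 2 * ‖F i‖ ≤ B / (θ ^ (k + 2) * R ^ k) := by
    intro i
    rw [le_div_iff₀ (by positivity)]
    refine le_trans ?_ (hF i)
    have hθ1 : 0 ≤ 1 - θ := nonneg_of_mul_nonneg_left ((abs_nonneg _).trans (hp i)) hR
    have h1 : θ * |x| ≤ |x + p i| := by
      have h2 := abs_sub_abs_le_abs_sub x (-p i)
      rw [abs_neg, sub_neg_eq_add] at h2
      have := mul_le_mul_of_nonneg_left hx hθ1
      linarith [hp i]
    calc x ^ 2 * ‖F i‖ * (θ ^ (k + 2) * R ^ k) = θ ^ (k + 2) * (R ^ k * |x| ^ 2) * ‖F i‖ := by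
          rw [sq_abs]; ring
      _ ≤ θ ^ (k + 2) * (|x| ^ k * |x| ^ 2) * ‖F i‖ := by gcongr
      _ = (θ * |x|) ^ (k + 2) * ‖F i‖ := by ring
      _ ≤ |x + p i| ^ (k + 2) * ‖F i‖ := by gcongr
  calc x ^ 2 * ‖∑ i, c i * F i‖ ≤ x ^ 2 * ∑ i, ‖c i * F i‖ := by gcongr; exact norm_sum_le _ _
    _ = ∑ i, ‖c i‖ * (x ^ 2 * ‖F i‖) := by
      rw [Finset.mul_sum]
      exact Finset.sum_congr rfl fun i _ => by rw [norm_mul]; ring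
    _ ≤ ∑ _i : ι, ‖c‖ * (B / (θ ^ (k + 2) * R ^ k)) := by
      refine Finset.sum_le_sum fun i _ => ?_
      exact mul_le_mul (norm_le_pi_norm c i) (key i) (by positivity) (norm_nonneg _)
    _ = _ := by simp

open FourierTransform in
lemma fourier_sum_mul {ι : Type*} [Fintype ι] (c : ι → ℂ) {A : ι → ℝ → ℂ}
    (hA : ∀ i, Integrable (A i)) (ξ : ℝ) :
    𝓕 (fun x => ∑ i, c i * A i x) ξ = ∑ i, c i * 𝓕 (A i) ξ := by
  simp only [Real.fourier_real_eq, Finset.smul_sum]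
  rw [integral_finsetSum]
  · refine Finset.sum_congr rfl fun i _ => ?_
    rw [← integral_const_mul]
    congr 1
    ext v
    simp only [Circle.smul_def, smul_eq_mul]
    ring
  · intro i _
    have h := (Real.fourierIntegral_convergent_iff (f := fun x => c i * A i x) (μ := volume)
      ξ).2 ((hA i).const_mul (c i))
    refine h.congr (Filter.Eventually.of_forall fun v => ?_)
    simp [mul_comm]

lemma exists_ne_zero_sum_mul_eq_zero {ι : Type*} [Fintype ι] (b : ι → ℤ → ℂ) {B : ℕ}
    (h : 2 * B + 1 < Fintype.card ι) :
    ∃ c : ι → ℂ, c ≠ 0 ∧ ∀ n : ℤ, |n| ≤ B → ∑ i, c i * b i n = 0 := by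
  classical
  let L : (ι → ℂ) →ₗ[ℂ] (↥(Finset.Icc (-(B : ℤ)) B) → ℂ) :=
    LinearMap.pi fun n => ∑ i, (b i n) • LinearMap.proj i
  have hcard : Fintype.card ↥(Finset.Icc (-(B : ℤ)) B) = 2 * B + 1 := by
    simp only [Fintype.card_coe, Int.card_Icc]; omega
  have hker : LinearMap.ker L ≠ ⊥ := by
    apply LinearMap.ker_ne_bot_of_finrank_lt
    rw [Module.finrank_fintype_fun_eq_card, Module.finrank_fintype_fun_eq_card, hcard]
    exact h
  obtain ⟨c, hc, hc0⟩ := Submodule.exists_mem_ne_zero_of_ne_bot hker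
  refine ⟨c, hc0, fun n hn => ?_⟩
  have h1 := congrFun (LinearMap.mem_ker.1 hc) ⟨n, Finset.mem_Icc.2 (abs_le.1 hn)⟩
  simpa [L, mul_comm] using h1

open FourierTransform in
lemma exists_gridAtom_localised (g : 𝓢(ℝ, ℂ) →L[ℂ] ℂ) (β : ContDiffBump (0 : ℝ))
    (T : Finset (ℤ × ℤ)) : ∃ m : ℕ, ∀ n : ℕ, ∃ C, 0 ≤ C ∧ ∀ (N : ℕ) (i : GridIndex T N),
      Continuous (gridAtom g β i) ∧ Integrable (gridAtom g β i) ∧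
      (∀ x, |x + (i.2.2 : ℤ) / (2 * β.rIn)| ^ n * ‖gridAtom g β i x‖ ≤
        C * (1 + N / (2 * β.rIn)) ^ (2 * m)) ∧
      ∀ ξ, |ξ + -((i.2.1 : ℤ) / (2 * β.rIn))| ^ n * ‖𝓕 (gridAtom g β i) ξ‖ ≤
        C * (1 + N / (2 * β.rIn)) ^ (2 * m) := by
  obtain ⟨m, hm⟩ := exists_atom_localised g
  refine ⟨m, fun n => ?_⟩
  choose C hC0 hC using fun j : ℤ × ℤ => hm (freqWindow β j.2) (timeWindow β j.1) n
  refine ⟨∑ j ∈ T, C j, Finset.sum_nonneg fun j _ => hC0 j, fun N i => ?_⟩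
  have ha : 0 < 2 * β.rIn := by have := β.rIn_pos; positivity
  have hfreq : ∀ k : ↥(Finset.Icc (-(N : ℤ)) N), |((k : ℤ) : ℝ) / (2 * β.rIn)| ≤
      N / (2 * β.rIn) := by
    intro k
    rw [abs_div, abs_of_pos ha]
    gcongr
    have := abs_le.2 (Finset.mem_Icc.1 k.2)
    exact_mod_cast this
  have hB : C i.1 * ((1 + |((i.2.2 : ℤ) : ℝ) / (2 * β.rIn)|) ^ m *
      (1 + |-(((i.2.1 : ℤ) : ℝ) / (2 * β.rIn))|) ^ m) ≤
      (∑ j ∈ T, C j) * (1 + N / (2 * β.rIn)) ^ (2 * m) := by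
    rw [abs_neg, two_mul m, pow_add]
    have h1 : C i.1 ≤ ∑ j ∈ T, C j := Finset.single_le_sum (fun j _ => hC0 j) i.1.2
    have h2 := hC0 i.1
    have h3 : 0 ≤ ∑ j ∈ T, C j := h2.trans h1
    gcongr
    · exact hfreq _
    · exact hfreq _
  obtain ⟨h1, h2, h3, h4⟩ := hC i.1 ((i.2.2 : ℤ) / (2 * β.rIn)) (-((i.2.1 : ℤ) / (2 * β.rIn)))
  exact ⟨h1, h2, fun x => (h3 x).trans hB, fun ξ => (h4 ξ).trans hB⟩

/-- When the squares of the grid have total area greater than one, some nontrivial combination of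
the atoms is small. -/
lemma exists_sum_gridAtom_small (g : 𝓢(ℝ, ℂ) →L[ℂ] ℂ) (β : ContDiffBump (0 : ℝ))
    {T : Finset (ℤ × ℤ)} (hT : 1 < T.card * (2 * β.rIn) ^ 2) :
    ∃ D : ℝ, 0 ≤ D ∧ ∀ N : ℕ, 1 ≤ N → ∃ c : GridIndex T N → ℂ, c ≠ 0 ∧
      ∀ x, (1 + x ^ 2) * ‖∑ i, c i * gridAtom g β i x‖ ≤ D * ‖c‖ / N := by
  have ha : 0 < 2 * β.rIn := by have := β.rIn_pos; positivity
  set a := 2 * β.rIn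
  obtain ⟨m, hm⟩ := exists_gridAtom_localised g β T
  obtain ⟨C, hC0, hC⟩ := hm (2 * m + 6 + 2)
  have hJ : 1 ≤ T.card := by
    rcases Nat.eq_zero_or_pos T.card with h | h
    · rw [h] at hT; norm_num at hT
    · exact h
  set s := √(T.card : ℝ) with hs
  have hs2 : s ^ 2 = T.card := Real.sq_sqrt (by positivity)
  have hs1 : 1 ≤ s := by
    rw [hs, Real.one_le_sqrt]; exact_mod_cast hJ
  have hsa : 1 < s * a := by
    rw [← hs2, ← mul_pow] at hT
    exact (one_lt_sq_iff₀ (by positivity)).1 hT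
  set θ := 1 - 1 / (s * a) with hθdef
  have hθ : 0 < θ := by
    rw [hθdef, sub_pos, div_lt_one (by positivity)]; exact hsa
  set K := 6 * ∑' n : ℤ, 1 / (n : ℝ) ^ 2 + 2 with hK
  have hK0 : 0 ≤ K := by
    have : 0 ≤ ∑' n : ℤ, 1 / (n : ℝ) ^ 2 := tsum_nonneg fun n => by positivity
    positivity
  refine ⟨K * (9 * (C * 4 ^ m) / θ ^ (2 * m + 6 + 2)), by positivity, fun N hN => ?_⟩
  have hN' : (1 : ℝ) ≤ N := by exact_mod_cast hN
  set R := s * N with hRdef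
  have hNR : (N : ℝ) ≤ R := le_mul_of_one_le_left (by positivity) hs1
  have hR1 : 1 ≤ R := hN'.trans hNR
  have hR2 : R ^ 2 = T.card * N ^ 2 := by rw [hRdef, mul_pow, hs2]
  have hL : N / a = (1 - θ) * R := by
    rw [hθdef, hRdef]; field_simp; ring
  have hLR : N / a ≤ R := by
    rw [hL]
    nlinarith
  obtain ⟨c, hc0, hc⟩ := exists_ne_zero_sum_mul_eq_zero (ι := GridIndex T N)
    (fun i n => FourierTransform.fourier (gridAtom g β i) (n / (2 * R)))
    (B := 2 * T.card * N ^ 2) (by rw [card_gridIndex]; nlinarith)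
  refine ⟨c, hc0, ?_⟩
  have hcard : (Fintype.card (GridIndex T N) : ℝ) ≤ 9 * R ^ 2 := by
    rw [card_gridIndex, hR2]
    push_cast
    have : (2 * (N : ℝ) + 1) ^ 2 ≤ 9 * N ^ 2 := by nlinarith
    nlinarith [(Nat.cast_nonneg T.card : (0 : ℝ) ≤ T.card)]
  set B := C * (1 + N / a) ^ (2 * m) with hBdef
  have hB : B ≤ C * 4 ^ m * R ^ (2 * m) := by
    have : (4 : ℝ) ^ m * R ^ (2 * m) = (R + R) ^ (2 * m) := by
      rw [← two_mul R, mul_pow 2 R, pow_mul 2]; norm_num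
    rw [mul_assoc, this, hBdef]
    gcongr
  have hfreq : ∀ k : ↥(Finset.Icc (-(N : ℤ)) N), |((k : ℤ) : ℝ) / a| ≤ (1 - θ) * R := by
    intro k
    rw [← hL, abs_div, abs_of_pos ha]
    gcongr
    have := abs_le.2 (Finset.mem_Icc.1 k.2)
    exact_mod_cast this
  intro x
  have hmain := one_add_sq_mul_norm_le_of_fourier_eq_zero
    (f := fun x => ∑ i, c i * gridAtom g β i x)
    (continuous_finsetSum _ fun i _ => continuous_const.mul (hC N i).1) hR1
    (E := Fintype.card (GridIndex T N) * (‖c‖ * (B / (θ ^ (2 * m + 6 + 2) * R ^ (2 * m + 6)))))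
    (by positivity)
    (fun x hx => sq_mul_norm_sum_mul_le c hθ (by linarith) (fun i => hfreq i.2.2) hx
      fun i => (hC N i).2.2.1 x)
    (fun ξ hξ => by
      rw [fourier_sum_mul c fun i => (hC N i).2.1]
      exact sq_mul_norm_sum_mul_le c hθ (by linarith)
        (fun i => (abs_neg _).trans_le (hfreq i.2.1)) hξ fun i => (hC N i).2.2.2 ξ)
    (fun n hn => by
      rw [fourier_sum_mul c fun i => (hC N i).2.1]
      refine hc n ?_
      rw [hR2] at hn
      have h : ((|n| : ℤ) : ℝ) ≤ ((2 * T.card * N ^ 2 : ℕ) : ℝ) := by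
        push_cast; linarith
      exact_mod_cast h) x
  refine hmain.trans ?_
  rw [← hK]
  calc K * (Fintype.card (GridIndex T N) *
        (‖c‖ * (B / (θ ^ (2 * m + 6 + 2) * R ^ (2 * m + 6)))) * R ^ 3)
      ≤ K * (9 * R ^ 2 * (‖c‖ * (C * 4 ^ m * R ^ (2 * m) /
        (θ ^ (2 * m + 6 + 2) * R ^ (2 * m + 6)))) * R ^ 3) := by gcongr
    _ = K * (9 * (C * 4 ^ m) / θ ^ (2 * m + 6 + 2)) * ‖c‖ / R := by
      have : R ≠ 0 := by positivity
      field_simp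
      ring
    _ ≤ _ := by gcongr

/-- **Non-identifiability of `OPW(M)` for open `M` with `μ(M) > 1`** (Theorem 1.3,
part 2, of the paper), stated via spreading functions: for every tempered distribution
`g` and every `ε > 0` there is a smooth, compactly supported, not identically zero
spreading function `η` supported inside `M` such that the operator response
`Hg(x) = g(y ↦ ∫ η(x − y, ν)e^{2πiνx} dν)` satisfies `‖Hg‖_{L²} ≤ ε·‖η‖_{L²(ℝ²)}`. -/
theorem stmt5 (M : Set (ℝ × ℝ)) (hM : IsOpen M) (hμ : 1 < volume M) :
    ∀ (g : 𝓢(ℝ, ℂ) →L[ℂ] ℂ) (ε : ℝ), 0 < ε →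
      ∃ η : ℝ × ℝ → ℂ,
        ContDiff ℝ (⊤ : ℕ∞) η ∧ HasCompactSupport η ∧ η ≠ 0 ∧ tsupport η ⊆ M ∧
        ∀ φ : ℝ → 𝓢(ℝ, ℂ),
          (∀ x y : ℝ, φ x y = ∫ ν : ℝ, η (x - y, ν) * Complex.exp (2 * π * Complex.I * ν * x)) →
          eLpNorm (fun x : ℝ => g (φ x)) 2 volume ≤ ENNReal.ofReal ε * eLpNorm η 2 volume := by
  intro g ε hε
  obtain ⟨r, hr, T, hT, hTM⟩ := exists_grid_squares hM hμ
  obtain ⟨r', hr', hr'r, hTr'⟩ : ∃ r', 0 < r' ∧ r' < r ∧ 1 < T.card * (2 * r') ^ 2 := by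
    have hcont : Continuous fun t : ℝ => T.card * (2 * t) ^ 2 := by fun_prop
    have h1 : ∀ᶠ t : ℝ in nhdsWithin r (Set.Iio r), 1 < T.card * (2 * t) ^ 2 :=
      (hcont.tendsto r).mono_left nhdsWithin_le_nhds |>.eventually (lt_mem_nhds hT)
    obtain ⟨t, h, ht⟩ := (h1.and (Ioo_mem_nhdsLT hr)).exists
    exact ⟨t, ht.1, ht.2, h⟩
  set β : ContDiffBump (0 : ℝ) := ⟨r', r, hr', hr'r⟩
  obtain ⟨D, hD0, hD⟩ := exists_sum_gridAtom_small g β hTr'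
  set W := eLpNorm (fun x : ℝ => (1 + x ^ 2)⁻¹) 2 volume
  have hW : W ≠ ⊤ := eLpNorm_inv_one_add_sq_lt_top.ne
  obtain ⟨N, hN⟩ := exists_nat_gt (max 1 (D * W.toReal / (ε * (2 * r'))))
  obtain ⟨hN1, hN2⟩ := max_lt_iff.1 hN
  obtain ⟨c, hc0, hc⟩ := hD N (by exact_mod_cast hN1.le)
  have hN0 : (0 : ℝ) < N := by linarith
  refine ⟨gridSum β c, contDiff_gridSum β c, hasCompactSupport_gridSum β c, gridSum_ne_zero β c hc0,
    (tsupport_gridSum_subset β c).trans (Set.iUnion₂_subset hTM), fun φ hφ => ?_⟩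
  have hresp : (fun x => g (φ x)) = fun x => ∑ i, c i * gridAtom g β i x :=
    funext (apply_eq_sum_gridAtom g β c φ hφ)
  rw [hresp]
  calc _ ≤ ENNReal.ofReal (D * ‖c‖ / N) * W := eLpNorm_two_le_of_one_add_sq_mul_norm_le hc
    _ = ENNReal.ofReal (D * ‖c‖ / N * W.toReal) := by
      rw [ENNReal.ofReal_mul (by positivity), ENNReal.ofReal_toReal hW]
    _ ≤ ENNReal.ofReal (ε * (‖c‖ * (2 * r'))) := by
      refine ENNReal.ofReal_le_ofReal ?_
      rw [div_lt_iff₀ (by positivity)] at hN2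
      rw [div_mul_eq_mul_div, div_le_iff₀ hN0]
      nlinarith [mul_le_mul_of_nonneg_left hN2.le (norm_nonneg c)]
    _ ≤ _ := by
      rw [ENNReal.ofReal_mul hε.le]
      gcongr
      exact norm_mul_le_eLpNorm_gridSum β c
end

section
/- Let L be a prime number. For c ∈ ℂ^L (indexed by ℤ/Lℤ) and (k, ℓ) ∈ (ℤ/Lℤ)², define the vector π(k,ℓ)c ∈ ℂ^L by (π(k,ℓ)c)_j = c_{j−k}·e^{2πi jℓ/L}, j ∈ ℤ/Lℤ. Then for Lebesgue-almost every c ∈ ℂ^L, the L² vectors {π(k,ℓ)c : (k,ℓ) ∈ (ℤ/Lℤ)²} are in general linear position: for every set S of L distinct pairs (k,ℓ), the family (π(k,ℓ)c)_{(k,ℓ)∈S} is linearly independent over ℂ (equivalently, the L×L matrix whose columns are these L vectors is invertible). -/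
open MeasureTheory Real

open Polynomial in
/-- In characteristic `p`, a nonzero polynomial of degree less than `p` has more nonzero
coefficients than the multiplicity of `1` as a root. -/
theorem Polynomial.lt_card_support_of_X_sub_one_pow_dvd {k : Type*} [Field k] (p : ℕ) [CharP k p]
    (t : ℕ) : ∀ f : k[X], f ≠ 0 → f.natDegree < p → (X - C 1) ^ t ∣ f → t < f.support.card := by
  induction t with
  | zero => intro f hf _ _; simpa [Finset.card_pos] using hf
  | succ t ih =>
    intro f hf hdeg hdvd
    set m := f.natDegree with hm
    set g : k[X] := X * derivative f - C (m : k) * f with hg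
    have hcoeff : ∀ n, g.coeff n = ((n : k) - m) * f.coeff n := by
      intro n
      cases n with
      | zero => simp [hg]
      | succ n => simp [hg, coeff_X_mul, coeff_derivative]; ring
    have hsupp : g.support = f.support.erase m := by
      ext n
      simp only [mem_support_iff, hcoeff, Finset.mem_erase, mul_ne_zero_iff]
      refine and_congr_left fun hn => not_congr ?_
      have hn' : n < p := (le_natDegree_of_ne_zero hn).trans_lt hdeg
      rw [sub_eq_zero, CharP.natCast_eq_natCast k p]
      exact ⟨fun h => Nat.ModEq.eq_of_lt_of_lt h hn' hdeg, fun h => h ▸ rfl⟩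
    have hcard : f.support.card = g.support.card + 1 := by
      rw [hsupp, Finset.card_erase_add_one]
      simpa [hm] using hf
    have hgdvd : (X - C 1) ^ t ∣ g := by
      refine dvd_sub (Dvd.dvd.mul_left ?_ _)
        (Dvd.dvd.mul_left ((pow_dvd_pow _ t.le_succ).trans hdvd) _)
      simpa using pow_sub_one_dvd_derivative_of_pow_dvd hdvd
    have hg0 : g ≠ 0 := by
      intro h0
      have hs : f.support = {m} := by
        rw [h0, support_zero] at hsupp
        have hmf : m ∈ f.support := by simpa [hm] using hf
        rw [← Finset.insert_erase hmf, ← hsupp]; rfl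
      have hroot : f.eval 1 = 0 :=
        dvd_iff_isRoot.mp ((dvd_pow_self _ t.succ_ne_zero).trans hdvd)
      rw [eval_eq_sum, sum_def, hs] at hroot
      exact hf (by simpa [hm] using hroot)
    have hgdeg : g.natDegree < p :=
      (natDegree_le_iff_coeff_eq_zero.mpr fun n hn => by
        rw [hcoeff, coeff_eq_zero_of_natDegree_lt hn, mul_zero]).trans_lt hdeg
    have := ih g hg0 hgdeg hgdvd
    omega

theorem ValuationSubring.exists_natCast_mem_nonunits (F : Type*) [Field F] [CharZero F] {p : ℕ}
    (hp : p.Prime) : ∃ V : ValuationSubring F, (p : F) ∈ V.nonunits := by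
  let A : Subring F := (Int.castRingHom F).range
  have hI : Ideal.span {(p : A)} ≠ ⊤ := by
    rw [Ne, Ideal.span_singleton_eq_top]
    intro h
    obtain ⟨⟨_, n, rfl⟩, hn⟩ := h.exists_right_inv
    have h1 : (p : F) * (n : F) = 1 := by simpa using congrArg (Subtype.val) hn
    have h2 : (p : ℤ) * n = 1 := by exact_mod_cast h1
    have := Int.eq_one_or_neg_one_of_mul_eq_one h2
    have := hp.two_le
    omega
  obtain ⟨V, -, hV⟩ := Ideal.image_subset_nonunits_valuationSubring _ hI
  exact ⟨V, hV ⟨(p : A), Ideal.mem_span_singleton_self _, by simp⟩⟩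

open Polynomial in
/-- **Chebotarëv's theorem on roots of unity**, in polynomial form. -/
theorem Polynomial.card_lt_card_support_of_pow_eq_one {F : Type*} [Field F] [CharZero F] {p : ℕ}
    (hp : p.Prime) {f : F[X]} (hf : f ≠ 0) (hdeg : f.natDegree < p) (A : Finset F)
    (hA : ∀ x ∈ A, x ^ p = 1) (hroot : ∀ x ∈ A, f.eval x = 0) : A.card < f.support.card := by
  classical
  obtain ⟨V, hV⟩ := ValuationSubring.exists_natCast_mem_nonunits F hp
  have : Fact p.Prime := ⟨hp⟩
  let k := IsLocalRing.ResidueField V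
  have hpk : (p : k) = 0 := by
    have h := V.coe_mem_nonunits_iff (a := (p : V)) |>.mp (by simpa using hV)
    simpa using (IsLocalRing.residue_eq_zero_iff _).mpr h
  have : CharP k p := (CharP.charP_iff_prime_eq_zero hp).mpr hpk
  obtain ⟨i, hi, hmax⟩ := Finset.exists_max_image f.support (fun i => V.valuation (f.coeff i))
    (by simpa using hf)
  have hi0 : f.coeff i ≠ 0 := by simpa using hi
  have hlift : C (f.coeff i)⁻¹ * f ∈ lifts V.subtype := by
    rw [lifts_iff_coeff_lifts]
    intro n
    suffices (f.coeff i)⁻¹ * f.coeff n ∈ V by simpa using this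
    by_cases hn : f.coeff n = 0
    · simp [hn, V.zero_mem]
    rw [← V.valuation_le_one_iff, map_mul, map_inv₀, inv_mul_le_one₀]
    · exact hmax n (by simpa using hn)
    · simpa [zero_lt_iff] using hi0
  obtain ⟨g, hg⟩ := (mem_lifts _).mp hlift
  have hinj : Function.Injective V.subtype := Subtype.val_injective
  have hg0 : g ≠ 0 := by
    rintro rfl
    simp [hi0, hf] at hg
  have hAV : ∀ x ∈ A, x ∈ V := by
    intro x hx
    have h := congrArg V.valuation (hA x hx)
    rw [map_pow, map_one] at h
    rw [← V.valuation_le_one_iff]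
    by_contra! h1
    exact (one_lt_pow₀ h1 hp.ne_zero).ne' h
  let B : Finset V := A.subtype (· ∈ V)
  have hdvd : (B.val.map fun a => X - C a).prod ∣ g := by
    rw [Multiset.prod_X_sub_C_dvd_iff_le_roots hg0, Multiset.le_iff_subset B.nodup]
    intro x hx
    have hx' : (x : F) ∈ A := by simpa [B] using hx
    rw [mem_roots hg0, IsRoot, ← hinj.eq_iff, ← eval_map_apply, hg]
    simp [hroot _ hx']
  have hB : ∀ x ∈ B, IsLocalRing.residue V x = 1 := by
    intro x hx
    have hx' : (x : F) ∈ A := by simpa [B] using hx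
    have h1 : x ^ p = 1 := Subtype.ext (by simpa using hA _ hx')
    have h2 : (IsLocalRing.residue V x - 1) ^ p = 0 := by
      rw [sub_pow_char, ← map_pow, h1]; simp
    exact sub_eq_zero.mp (pow_eq_zero_iff hp.ne_zero |>.mp h2)
  have hcardB : B.card = A.card := by
    rw [Finset.card_subtype, Finset.filter_true_of_mem hAV]
  have hdvd' : (X - C 1) ^ A.card ∣ g.map (IsLocalRing.residue V) := by
    have := Polynomial.map_dvd (IsLocalRing.residue V) hdvd
    rw [Polynomial.map_multiset_prod, Multiset.map_map, Multiset.map_congr rfl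
      (g := fun _ => X - C 1) (fun x hx => by simp [hB x hx])] at this
    simpa [hcardB] using this
  have hcoeff (n : ℕ) : ((g.coeff n : V) : F) = (f.coeff i)⁻¹ * f.coeff n := by
    simpa using congrArg (coeff · n) hg
  have hgi : g.coeff i = 1 := Subtype.ext (by simp [hcoeff, hi0])
  have hsupp : (g.map (IsLocalRing.residue V)).support ⊆ f.support := by
    intro n hn
    have : g.coeff n ≠ 0 := fun h => by simp [h] at hn
    rw [mem_support_iff]
    intro h
    exact this (Subtype.ext (by simp [hcoeff, h]))
  refine (lt_card_support_of_X_sub_one_pow_dvd p _ _ (fun h => ?_) ?_ hdvd').trans_le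
    (Finset.card_le_card hsupp)
  · simpa [hgi] using congrArg (coeff · i) h
  · exact (natDegree_le_iff_coeff_eq_zero.mpr fun n hn => by
      by_contra h
      exact notMem_support_iff.mpr (coeff_eq_zero_of_natDegree_lt hn)
        (hsupp (mem_support_iff.mpr h))).trans_lt hdeg

/-- A linear family of matrices containing one invertible matrix is almost everywhere invertible. -/
theorem LinearMap.ae_det_ne_zero {E n : Type*} [NormedAddCommGroup E] [NormedSpace ℂ E]
    [MeasurableSpace E] [BorelSpace E] [FiniteDimensional ℂ E] (μ : Measure E)
    [μ.IsAddHaarMeasure] [Fintype n] [DecidableEq n]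
    (M : E →ₗ[ℂ] Matrix n n ℂ) {x₀ : E} (hx₀ : (M x₀).det ≠ 0) : ∀ᵐ x ∂μ, (M x).det ≠ 0 := by
  have : ProperSpace E := FiniteDimensional.proper ℂ E
  have hcont : Continuous fun x => (M x).det := by
    have : Continuous M := M.continuous_of_finiteDimensional
    exact this.matrix_det
  have hmeas : MeasurableSet {x | (M x).det ≠ 0} :=
    (isOpen_ne.preimage hcont).measurableSet
  refine ae_mem_of_ae_add_linearMap_mem (LinearMap.toSpanSingleton ℂ E x₀) volume μ hmeas fun y => ?_
  have hu : IsUnit (M x₀).det := isUnit_iff_ne_zero.mpr hx₀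
  set N := -((M x₀)⁻¹ * M y)
  have hfin : {t : ℂ | N.charpoly.eval t = 0}.Finite :=
    (N.charpoly.rootSet_finite ℂ).subset fun t ht => by
      rw [Polynomial.mem_rootSet]; exact ⟨N.charpoly_monic.ne_zero, by simpa using ht⟩
  filter_upwards [hfin.countable.ae_notMem volume] with t ht
  have key : M (y + t • x₀) = M x₀ * (Matrix.scalar n t - N) := by
    rw [sub_neg_eq_add, mul_add, Matrix.mul_nonsing_inv_cancel_left _ _ hu, map_add, map_smul,
      add_comm]
    congr 1
    simp [Matrix.scalar_apply, ← Matrix.smul_one_eq_diagonal]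
  change (M (y + t • x₀)).det ≠ 0
  rw [key, Matrix.det_mul, ← Matrix.eval_charpoly]
  exact mul_ne_zero hx₀ ht

/-- An assignment of maximal weight is unique, if any two different weights in a line of the
table `w` differ by a factor of at least three. -/
theorem Equiv.Perm.comp_eq_of_isMax_sum {n K : Type*} [Fintype n] [DecidableEq n]
    (f : n → K) (w : n → K → ℕ)
    (hpos : ∀ i k, 0 < w i k)
    (hrow : ∀ i k k', k ≠ k' → w i k' ≤ w i k → 3 * w i k' ≤ w i k)
    (hcol : ∀ i i' k, i ≠ i' → w i' k ≤ w i k → 3 * w i' k ≤ w i k)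
    (σ τ : Equiv.Perm n)
    (hσ : ∀ ρ : Equiv.Perm n, ∑ i, w i (f (ρ i)) ≤ ∑ i, w i (f (σ i)))
    (hτ : ∀ ρ : Equiv.Perm n, ∑ i, w i (f (ρ i)) ≤ ∑ i, w i (f (τ i))) :
    f ∘ σ = f ∘ τ := by
  classical
  by_contra hne
  let D : Finset n := {i | f (σ i) ≠ f (τ i)}
  have hD : D.Nonempty := by
    obtain ⟨i, hi⟩ := Function.ne_iff.mp hne
    exact ⟨i, by simpa [D] using hi⟩
  obtain ⟨i, hi, hmax⟩ := D.exists_max_image (fun i => max (w i (f (σ i))) (w i (f (τ i)))) hD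
  wlog hle : w i (f (τ i)) ≤ w i (f (σ i)) generalizing σ τ
  · refine this τ σ hτ hσ (Ne.symm hne) ?_ ?_ ?_ (le_of_not_ge hle)
    · simpa [D, Finset.Nonempty, eq_comm] using hD
    · simpa [D, eq_comm] using hi
    · simpa [D, eq_comm, max_comm] using hmax
  have hi' : f (σ i) ≠ f (τ i) := by simpa [D] using hi
  have hcard (ρ : Equiv.Perm n) :
      (Finset.univ.filter fun j => f (ρ j) = f (σ i)).card =
        (Finset.univ.filter fun j => f j = f (σ i)).card :=
    Finset.card_equiv ρ (by simp)
  obtain ⟨j, hj, hjσ⟩ : ∃ j, f (τ j) = f (σ i) ∧ f (σ j) ≠ f (σ i) := by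
    by_contra! h
    have := Finset.eq_of_subset_of_card_le
      (s := Finset.univ.filter fun j => f (τ j) = f (σ i))
      (t := Finset.univ.filter fun j => f (σ j) = f (σ i))
      (fun j hj => by simpa using h j (by simpa using hj)) (by rw [hcard, hcard])
    have hiτ : i ∈ Finset.univ.filter fun j => f (τ j) = f (σ i) := this ▸ by simp
    exact hi' (by simpa [eq_comm] using hiτ)
  have hij : i ≠ j := fun h => hjσ (by rw [h])
  have hjD : j ∈ D := by simpa [D, hj] using hjσ
  have h1 := hrow i _ _ hi' hle
  have h2 := hcol i j (f (σ i)) hij (by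
    have := hmax j hjD
    rw [max_eq_left hle, hj] at this
    exact (le_max_right _ _).trans this)
  have hsum := hτ (τ * Equiv.swap i j)
  have split (g : n → ℕ) : ∑ l, g l = g i + (g j + ∑ l ∈ (Finset.univ.erase i).erase j, g l) := by
    rw [Finset.add_sum_erase _ _ (by simp [hij.symm]), Finset.add_sum_erase _ _ (by simp)]
  rw [split, split fun l => w l (f (τ l))] at hsum
  have hrest : ∑ l ∈ (Finset.univ.erase i).erase j, w l (f ((τ * Equiv.swap i j) l)) =
      ∑ l ∈ (Finset.univ.erase i).erase j, w l (f (τ l)) := by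
    refine Finset.sum_congr rfl fun l hl => ?_
    simp only [Finset.mem_erase, Finset.mem_univ, and_true] at hl
    rw [Equiv.Perm.mul_apply, Equiv.swap_apply_of_ne_of_ne hl.2 hl.1]
  rw [hrest] at hsum
  simp only [Equiv.Perm.mul_apply, Equiv.swap_apply_left, Equiv.swap_apply_right, hj] at hsum
  have := hpos i (f (σ i))
  omega

/-- If for every assignment `f ∘ τ` of columns to blocks of rows the corresponding block part of
`a` is nonsingular, then so is `a`, weighted entrywise by `c (e i - f s)`, for a suitable `c`. -/
theorem Matrix.exists_det_ne_zero_of_forall_blocks {n G R : Type*} [Fintype n] [DecidableEq n]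
    [AddGroup G] [DecidableEq G] [CommRing R] [IsDomain R] [Infinite R]
    (v : G → ℕ) (hv : Function.Injective v) (N : ℕ) (hN : ∀ z, v z ≤ N)
    (f e : n → G) (he : Function.Injective e) (a : Matrix n n R)
    (h : ∀ τ : Equiv.Perm n,
      (Matrix.of fun s i => if f s = f (τ i) then a s i else 0).det ≠ 0) :
    ∃ c : G → R, (Matrix.of fun s i => c (e i - f s) * a s i).det ≠ 0 := by
  let w (i : n) (k : G) : ℕ := 3 ^ (N - v (e i - k))
  have hw (x y : G) (hxy : x ≠ y) (hle : 3 ^ (N - v y) ≤ 3 ^ (N - v x)) :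
      3 * 3 ^ (N - v y) ≤ 3 ^ (N - v x) := by
    have h1 := (Nat.pow_le_pow_iff_right (by norm_num)).mp hle
    have h2 : v x ≠ v y := hv.ne hxy
    have := hN x
    have := hN y
    rw [← pow_succ']
    exact Nat.pow_le_pow_right (by norm_num) (by omega)
  obtain ⟨τ, hτ⟩ := Finite.exists_max fun σ : Equiv.Perm n => ∑ i, w i (f (σ i))
  let m (σ : Equiv.Perm n) : G →₀ ℕ := ∑ i, Finsupp.single (e i - f (σ i)) 1
  have hm (σ : Equiv.Perm n) : m σ = m τ ↔ ∀ i, f (σ i) = f (τ i) := by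
    refine ⟨fun hστ => ?_, fun hστ => by simp [m, hστ]⟩
    have hweight (ρ : Equiv.Perm n) :
        ∑ i, w i (f (ρ i)) = (m ρ).sum fun z r => r * 3 ^ (N - v z) := by
      rw [← Finsupp.sum_finsetSum_index (by simp) (by intros; ring)]
      simp [w]
    refine congrFun (Equiv.Perm.comp_eq_of_isMax_sum f w (fun _ _ => by positivity)
      (fun i k k' hk hle => hw _ _ (by simpa using hk) hle)
      (fun i i' k hi hle => hw _ _ (by simpa using he.ne hi) hle) σ τ (fun ρ => ?_) hτ)
    rw [hweight σ, hστ, ← hweight τ]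
    exact hτ ρ
  let P : Matrix n n (MvPolynomial G R) :=
    Matrix.of fun s i => MvPolynomial.monomial (Finsupp.single (e i - f s) 1) (a s i)
  have hP : P.det.coeff (m τ) =
      (Matrix.of fun s i => if f s = f (τ i) then a s i else 0).det := by
    rw [Matrix.det_apply', Matrix.det_apply', MvPolynomial.coeff_sum]
    refine Finset.sum_congr rfl fun σ _ => ?_
    have hprod : ∏ i, P (σ i) i = MvPolynomial.monomial (m σ) (∏ i, a (σ i) i) := by
      exact (MvPolynomial.monomial_sum_prod _ _ _).symm
    rw [hprod, ← map_intCast (MvPolynomial.C (σ := G) (R := R)), MvPolynomial.coeff_C_mul,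
      MvPolynomial.coeff_monomial]
    congr 1
    simp only [hm, Matrix.of_apply]
    split_ifs with hσ
    · exact Finset.prod_congr rfl fun i _ => by rw [if_pos (hσ i)]
    · push Not at hσ
      obtain ⟨i, hi⟩ := hσ
      exact (Finset.prod_eq_zero (Finset.mem_univ i) (if_neg hi)).symm
  by_contra! hc
  refine h τ (hP ▸ ?_)
  suffices P.det = 0 by simp [this]
  refine MvPolynomial.funext fun c => ?_
  rw [RingHom.map_det, map_zero, ← hc c]
  congr 1
  ext s i
  simp [P, MvPolynomial.eval_monomial, mul_comm]

/-- A block of rows and an equally large block of columns of the Fourier matrix of prime order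
form an invertible matrix, and so do several such blocks together. -/
theorem IsPrimitiveRoot.det_blocks_ne_zero {F : Type*} [Field F] [CharZero F] {p : ℕ}
    [NeZero p] (hp : p.Prime) {ω : F} (hω : IsPrimitiveRoot ω p)
    {n : Type*} [Fintype n] [DecidableEq n]
    {K : Type*} [DecidableEq K] (f : n → K) (g e : n → ZMod p)
    (hfg : Function.Injective fun s => (f s, g s)) (he : Function.Injective e)
    (τ : Equiv.Perm n) :
    (Matrix.of fun s i => if f s = f (τ i) then ω ^ ((e i).val * (g s).val) else 0).det ≠ 0 := by
  intro hdet
  obtain ⟨v, hv0, hv⟩ := Matrix.exists_vecMul_eq_zero_iff.mpr hdet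
  refine hv0 (funext fun s₀ => ?_)
  let B : Finset n := {s | f s = f s₀}
  let A : Finset n := {i | f (τ i) = f s₀}
  let q : Polynomial F := ∑ s ∈ B, Polynomial.monomial (g s).val (v s)
  have hcoeff : q.coeff (g s₀).val = v s₀ := by
    rw [Polynomial.finsetSum_coeff, Finset.sum_eq_single s₀]
    · simp
    · intro s hs hne
      rw [Polynomial.coeff_monomial, if_neg]
      intro h
      exact hne (hfg (Prod.ext (by simpa [B] using hs) (ZMod.val_injective p h)))
    · simp [B]
  rw [Pi.zero_apply, ← hcoeff]
  by_contra hq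
  have hq0 : q ≠ 0 := by intro h; simp [h] at hq
  have hsupp : q.support ⊆ B.image fun s => (g s).val := by
    intro r hr
    by_contra hr'
    refine Polynomial.mem_support_iff.mp hr ?_
    rw [Polynomial.finsetSum_coeff]
    refine Finset.sum_eq_zero fun s hs => ?_
    rw [Polynomial.coeff_monomial, if_neg]
    exact fun h => hr' (Finset.mem_image.mpr ⟨s, hs, h⟩)
  have hdeg : q.natDegree < p := by
    obtain ⟨s, -, hs⟩ := Finset.mem_image.mp
      (hsupp (Polynomial.natDegree_mem_support_of_nonzero hq0))
    exact hs ▸ ZMod.val_lt _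
  have hinj : Function.Injective fun i => ω ^ (e i).val := fun i j h =>
    he (ZMod.val_injective p (hω.pow_inj (ZMod.val_lt _) (ZMod.val_lt _) h))
  have hlt := Polynomial.card_lt_card_support_of_pow_eq_one hp hq0 hdeg (A.map ⟨_, hinj⟩)
    (by
      intro x hx
      obtain ⟨i, -, rfl⟩ := Finset.mem_map.mp hx
      change (ω ^ (e i).val) ^ p = 1
      rw [pow_right_comm, hω.pow_eq_one, one_pow])
    (by
      intro x hx
      obtain ⟨i, hi, rfl⟩ := Finset.mem_map.mp hx
      have hi' : f (τ i) = f s₀ := by simpa [A] using hi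
      have := congrFun hv i
      simpa [q, B, Matrix.vecMul, dotProduct, Polynomial.eval_finsetSum, Finset.sum_filter,
        apply_ite (Polynomial.eval _), hi', pow_mul] using this)
  have hcard : A.card = B.card := Finset.card_equiv τ (by simp [A, B])
  have := Finset.card_le_card hsupp
  have := Finset.card_image_le (s := B) (f := fun s => (g s).val)
  rw [Finset.card_map] at hlt
  omega

/-- **Discrete Gabor frames in general linear position** (Theorem 4.9 of the paper,
quoted from Lawrence–Pfander–Walnut).  For `L` prime and the time–frequency shifts
`(π(k,ℓ)c)_j = c_{j−k}·e^{2πi jℓ/L}` on `ℂ^L`, Lebesgue-almost every `c ∈ ℂ^L` has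
the property that any `L` distinct vectors `π(k,ℓ)c` are linearly independent. -/
theorem stmt6 (L : ℕ) [NeZero L] (hL : Nat.Prime L) :
    ∀ᵐ c : ZMod L → ℂ ∂volume,
      ∀ S : Finset (ZMod L × ZMod L), S.card = L →
        LinearIndependent ℂ
          (fun kl : {p : ZMod L × ZMod L // p ∈ S} => fun j : ZMod L =>
            c (j - kl.val.1) *
              Complex.exp (2 * π * Complex.I * ((j.val : ℂ) * (kl.val.2.val : ℂ)) / (L : ℂ))) := by
  rw [ae_all_iff]
  intro S
  by_cases hS : S.card = L
  swap
  · exact .of_forall fun _ h => absurd h hS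
  have hω := Complex.isPrimitiveRoot_exp L (NeZero.ne L)
  set ω := Complex.exp (2 * π * Complex.I / L) with hωdef
  have e : S ≃ ZMod L := Fintype.equivOfCardEq (by simp [hS, ZMod.card])
  obtain ⟨c₀, hc₀⟩ := Matrix.exists_det_ne_zero_of_forall_blocks (R := ℂ) (ZMod.val (n := L))
    (ZMod.val_injective L) L (fun z => (ZMod.val_lt z).le) (fun s : S => s.val.1) e e.injective
    (Matrix.of fun s i => ω ^ ((e i).val * s.val.2.val))
    (hω.det_blocks_ne_zero hL _ (fun s : S => s.val.2) e Subtype.val_injective e.injective)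
  let M : (ZMod L → ℂ) →ₗ[ℂ] Matrix S S ℂ :=
    { toFun c := Matrix.of fun s i => c (e i - s.val.1) * ω ^ ((e i).val * s.val.2.val)
      map_add' c d := by ext; simp [add_mul]
      map_smul' r c := by ext; simp [mul_assoc] }
  filter_upwards [M.ae_det_ne_zero volume (x₀ := c₀) hc₀] with c hc _
  have hli := Matrix.linearIndependent_rows_iff_isUnit.mpr
    ((Matrix.isUnit_iff_isUnit_det _).mpr (isUnit_iff_ne_zero.mpr hc))
  refine LinearIndependent.of_comp (LinearMap.funLeft ℂ ℂ e) ?_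
  convert! hli using 1
  ext s i
  simp only [Function.comp_apply, LinearMap.funLeft_apply, M, LinearMap.coe_mk, AddHom.coe_mk,
    Matrix.row_apply, Matrix.of_apply, hωdef, ← Complex.exp_nat_mul]
  congr 2
  push_cast
  ring
end

section
/- Let D ≥ 1 be an integer, let u > 1, K₀ > 0, C, γ, C̃, γ̃ > 0 and 0 < β < β̃, and set v(n) = C·e^{γ·‖n‖_∞^β} for n ∈ ℤ^D. Let m : ℤ^D × ℤ^D → ℂ be a bi-infinite matrix satisfying |m(j', j)| ≤ C̃·e^{−γ̃·(u‖j'‖_∞ − ‖j‖_∞)^{β̃}} whenever u‖j'‖_∞ − ‖j‖_∞ > K₀. Then for every ε > 0 there exists a finitely supported x : ℤ^D → ℂ such that |x(j)| ≤ v(j) for all j ∈ ℤ^D, |x(j₀)| = v(j₀) for some j₀ ∈ ℤ^D, and Σ_{j'∈ℤ^D} v(j')·|Σ_{j∈ℤ^D} m(j', j)·x(j)| ≤ ε. Consequently, m does not admit a lower bound of the form ‖Mx‖_{ℓ¹_v} ≥ c·‖x‖_{ℓ^∞_{1/v}} with c > 0 on finitely supported sequences. -/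
open Real

open Filter Asymptotics Topology in
/-- A stretched exponential with the larger exponent beats every polynomial, even against
growth of a stretched exponential with a smaller exponent. -/
lemma isBigO_pow_mul_exp_sub_rpow {β β' κ : ℝ} (hβ : 0 < β) (hββ' : β < β') (hκ : 0 < κ)
    (a : ℝ) (D : ℕ) (r : ℝ) :
    (fun t : ℝ => (2 * t + 1) ^ D * Real.exp (a * t ^ β - κ * t ^ β')) =O[atTop]
      (fun t : ℝ => t ^ r) := by
  have h_exp : ∀ᶠ t : ℝ in atTop, Real.exp (a * t ^ β - κ * t ^ β') ≤ Real.exp (-1 * t ^ β) := by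
    filter_upwards [(tendsto_rpow_atTop (sub_pos.2 hββ')).eventually_ge_atTop ((a + 1) / κ),
      eventually_gt_atTop 0] with t ht ht0
    have hsplit : t ^ β' = t ^ β * t ^ (β' - β) := by
      rw [← Real.rpow_add ht0]; congr 1; ring
    have hpos : 0 < t ^ β := Real.rpow_pos_of_pos ht0 _
    rw [div_le_iff₀ hκ] at ht
    apply Real.exp_le_exp.2
    rw [hsplit]
    nlinarith [mul_le_mul_of_nonneg_left ht hpos.le]
  have h1 : (fun t : ℝ => Real.exp (a * t ^ β - κ * t ^ β')) =O[atTop]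
      (fun t : ℝ => t ^ (r - D)) := by
    refine (IsBigO.of_bound' (g := fun t : ℝ => Real.exp (-1 * t ^ β)) ?_).trans ?_
    · filter_upwards [h_exp] with t ht
      simpa only [Real.norm_eq_abs, Real.abs_exp] using ht
    · have := ((isLittleO_exp_neg_mul_rpow_atTop one_pos ((r - D) / β)).comp_tendsto
        (tendsto_rpow_atTop hβ)).isBigO
      refine this.trans (EventuallyEq.isBigO ?_)
      filter_upwards [eventually_gt_atTop 0] with t ht
      simp only [Function.comp]
      rw [← Real.rpow_mul ht.le, mul_div_cancel₀ _ hβ.ne']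
  have h2 : (fun t : ℝ => (2 * t + 1) ^ D) =O[atTop] (fun t : ℝ => t ^ D) := by
    refine IsBigO.pow (IsBigO.of_bound 3 ?_) D
    filter_upwards [eventually_ge_atTop 1] with t ht
    rw [Real.norm_of_nonneg (by linarith), Real.norm_of_nonneg (by linarith)]
    linarith
  refine (h2.mul h1).trans (EventuallyEq.isBigO ?_)
  filter_upwards [eventually_gt_atTop 0] with t ht
  rw [← Real.rpow_natCast, ← Real.rpow_add ht]
  congr 1
  ring

/-- Some negative power of the norm is summable over the integer lattice `ℤ^D`. -/
lemma exists_summable_norm_rpow_int_pi (D : ℕ) :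
    ∃ r : ℝ, Summable fun n : Fin D → ℤ => ‖n‖ ^ r := by
  let L := Submodule.span ℤ (Set.range (Pi.basisFun ℝ (Fin D)))
  have hmem : ∀ n : Fin D → ℤ, (fun i => (n i : ℝ)) ∈ L := by
    intro n
    rw [Module.Basis.mem_span_iff_repr_mem]
    intro i
    exact ⟨n i, by simp⟩
  let e : (Fin D → ℤ) → L := fun n => ⟨_, hmem n⟩
  have he : Function.Injective e := by
    intro n n' h
    funext i
    have hi : (n i : ℝ) = n' i := congrFun (congrArg Subtype.val h) i
    exact_mod_cast hi
  refine ⟨-Module.finrank ℤ L - 1,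
    ((ZLattice.summable_norm_rpow L (-Module.finrank ℤ L - 1) (sub_one_lt _)).comp_injective he).congr fun n => ?_⟩
  have : ‖e n‖ = ‖n‖ := by
    simp only [e, Submodule.coe_norm, Pi.norm_def]
    congr 1
  simp only [Function.comp, this]

open Filter in
lemma summable_pow_mul_exp_sub_rpow {β β' κ : ℝ} (hβ : 0 < β) (hββ' : β < β') (hκ : 0 < κ)
    (a : ℝ) (D : ℕ) :
    Summable fun n : Fin D → ℤ =>
      (2 * ‖n‖ + 1) ^ D * Real.exp (a * ‖n‖ ^ β - κ * ‖n‖ ^ β') := by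
  obtain ⟨r, hr⟩ := exists_summable_norm_rpow_int_pi D
  have htends : Tendsto (fun n : Fin D → ℤ => ‖n‖) cofinite atTop := by
    rw [← cocompact_eq_cofinite]
    exact tendsto_norm_cocompact_atTop
  exact summable_of_isBigO hr
    ((isBigO_pow_mul_exp_sub_rpow hβ hββ' hκ a D r).comp_tendsto htends)

open Filter Topology in
/-- The tails of a summable family, cut off by a real-valued function, tend to zero. -/
lemma Summable.tendsto_tsum_ite_le {ι : Type*} {g : ι → ℝ} (hg : Summable g) (f : ι → ℝ) :
    Tendsto (fun N : ℕ => ∑' i, if (N : ℝ) ≤ f i then g i else 0) atTop (𝓝 0) := by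
  have := tendsto_tsum_of_dominated_convergence (𝓕 := atTop)
    (f := fun (N : ℕ) i => if (N : ℝ) ≤ f i then g i else 0) (g := fun _ => (0 : ℝ))
    (bound := fun i => ‖g i‖) hg.norm (fun i => ?_) (Eventually.of_forall fun N i => ?_)
  · simpa using this
  · refine tendsto_const_nhds.congr' ?_
    filter_upwards [tendsto_natCast_atTop_atTop.eventually_gt_atTop (f i)] with N hN
    rw [if_neg (not_le.2 hN)]
  · split_ifs <;> simp

/-- An underdetermined homogeneous system has a nontrivial solution. -/
lemma exists_ne_zero_sum_mul_eq_zero_s7 {ι κ : Type*} (m : ι → κ → ℂ) (t : Finset ι)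
    (s : Finset κ) (hts : t.card < s.card) :
    ∃ x : κ → ℂ, x ≠ 0 ∧ (∀ j ∉ s, x j = 0) ∧ ∀ i ∈ t, ∑ j ∈ s, m i j * x j = 0 := by
  classical
  let A : Matrix t s ℂ := Matrix.of fun i j => m i j
  have hker : LinearMap.ker A.mulVecLin ≠ ⊥ :=
    LinearMap.ker_ne_bot_of_finrank_lt (by simpa using hts)
  obtain ⟨y, hy, hy0⟩ := Submodule.exists_mem_ne_zero_of_ne_bot hker
  refine ⟨fun j => if h : j ∈ s then y ⟨j, h⟩ else 0, ?_, fun j hj => dif_neg hj, ?_⟩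
  · obtain ⟨j, hj⟩ := Function.ne_iff.1 hy0
    refine Function.ne_iff.2 ⟨j, ?_⟩
    simpa using hj
  · intro i hi
    have := congrFun (LinearMap.mem_ker.1 hy) ⟨i, hi⟩
    rw [← Finset.sum_coe_sort s]
    simpa [Matrix.mulVec, dotProduct, A] using this

/-- Normalisation of a finitely supported vector in a weighted supremum norm. -/
lemma exists_smul_norm_le_weight {κ : Type*} (v : κ → ℝ) (hv : ∀ j, 0 < v j) (s : Finset κ)
    (x : κ → ℂ) (hx : x ≠ 0) (hxs : ∀ j ∉ s, x j = 0) :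
    ∃ a : ℂ, (∀ j, ‖a * x j‖ ≤ v j) ∧ ∃ j₀ ∈ s, ‖a * x j₀‖ = v j₀ := by
  obtain ⟨k, hk⟩ := Function.ne_iff.1 hx
  have hks : k ∈ s := by
    by_contra h
    exact hk (hxs k h)
  obtain ⟨j₀, hj₀, hmax⟩ := s.exists_max_image (fun j => ‖x j‖ / v j) ⟨k, hks⟩
  have hpos : 0 < ‖x j₀‖ / v j₀ :=
    (div_pos (norm_pos_iff.2 hk) (hv k)).trans_le (hmax k hks)
  have hxj : ‖x j₀‖ ≠ 0 := fun h => by simp [h] at hpos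
  have hvj := (hv j₀).ne'
  have hnorm : ∀ j, ‖(((‖x j₀‖ / v j₀)⁻¹ : ℝ) : ℂ) * x j‖ = (‖x j₀‖ / v j₀)⁻¹ * ‖x j‖ := by
    intro j
    rw [norm_mul, Complex.norm_real, Real.norm_of_nonneg (inv_nonneg.2 hpos.le)]
  refine ⟨(((‖x j₀‖ / v j₀)⁻¹ : ℝ) : ℂ), fun j => ?_, j₀, hj₀, ?_⟩
  · rw [hnorm]
    by_cases hj : j ∈ s
    · have := hmax j hj
      rw [div_le_iff₀ (hv j)] at this
      rwa [inv_mul_le_iff₀ hpos]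
    · simpa [hxs j hj] using (hv j).le
  · rw [hnorm]
    field_simp

/-- The integer box of radius `N` in the maximum norm. -/
noncomputable def intBox (D : ℕ) (N : ℤ) : Finset (Fin D → ℤ) :=
  Finset.Icc (fun _ => -N) (fun _ => N)

lemma mem_intBox {D : ℕ} {N : ℕ} {n : Fin D → ℤ} : n ∈ intBox D N ↔ ‖n‖ ≤ N := by
  rw [pi_norm_le_iff_of_nonneg (Nat.cast_nonneg N), intBox, Finset.mem_Icc, Pi.le_def, Pi.le_def,
    ← forall_and]
  refine forall_congr' fun i => ?_
  rw [← abs_le, Int.norm_eq_abs]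
  exact_mod_cast Iff.rfl

lemma card_intBox (D N : ℕ) : (intBox D N).card = (2 * N + 1) ^ D := by
  simp only [intBox, Pi.card_Icc, Int.card_Icc, Finset.prod_const, Finset.card_univ,
    Fintype.card_fin]
  congr 1
  omega

/-- **No lower bound for matrices with subexponential off-diagonal decay**
(core claim of Theorem 4.13 of the paper).  If the bi-infinite matrix
`m : ℤ^D × ℤ^D → ℂ` satisfies `|m(j',j)| ≤ C̃·e^{−γ̃(u‖j'‖_∞ − ‖j‖_∞)^β̃}` whenever
`u‖j'‖_∞ − ‖j‖_∞ > K₀` (with `u > 1`, `β̃ > β`), and `v(n) = C·e^{γ‖n‖_∞^β}`,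
then there are finitely supported `x` with `|x| ≤ v` pointwise, `|x(j₀)| = v(j₀)`
somewhere, and weighted image `Σ_{j'} v(j')·|Σ_j m(j',j)x(j)|` arbitrarily small;
hence no bound `‖Mx‖_{ℓ¹_v} ≥ c‖x‖_{ℓ^∞_{1/v}}` holds. -/
theorem stmt7 (D : ℕ) (hD : 1 ≤ D)
    (u K₀ C γ C' γ' β β' : ℝ)
    (hu : 1 < u) (hK₀ : 0 < K₀) (hC : 0 < C) (hγ : 0 < γ) (hC' : 0 < C') (hγ' : 0 < γ')
    (hβ : 0 < β) (hββ' : β < β')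
    (v : (Fin D → ℤ) → ℝ) (hv : ∀ n, v n = C * Real.exp (γ * ‖n‖ ^ β))
    (m : (Fin D → ℤ) → (Fin D → ℤ) → ℂ)
    (hm : ∀ j' j : Fin D → ℤ, K₀ < u * ‖j'‖ - ‖j‖ →
      ‖m j' j‖ ≤ C' * Real.exp (-γ' * (u * ‖j'‖ - ‖j‖) ^ β')) :
    (∀ ε : ℝ, 0 < ε →
      ∃ x : (Fin D → ℤ) → ℂ,
        (Function.support x).Finite ∧
        (∀ j, ‖x j‖ ≤ v j) ∧
        (∃ j₀, ‖x j₀‖ = v j₀) ∧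
        Summable (fun j' : Fin D → ℤ => v j' * ‖∑' j : Fin D → ℤ, m j' j * x j‖) ∧
        (∑' j' : Fin D → ℤ, v j' * ‖∑' j : Fin D → ℤ, m j' j * x j‖) ≤ ε) ∧
    ¬ ∃ c : ℝ, 0 < c ∧
        ∀ x : (Fin D → ℤ) → ℂ, (Function.support x).Finite →
          c * (⨆ j : Fin D → ℤ, ‖x j‖ / v j)
            ≤ ∑' j' : Fin D → ℤ, v j' * ‖∑' j : Fin D → ℤ, m j' j * x j‖ := by
  have hv0 : ∀ n, 0 < v n := fun n => by rw [hv]; positivity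
  have main : ∀ ε : ℝ, 0 < ε →
      ∃ x : (Fin D → ℤ) → ℂ,
        (Function.support x).Finite ∧
        (∀ j, ‖x j‖ ≤ v j) ∧
        (∃ j₀, ‖x j₀‖ = v j₀) ∧
        Summable (fun j' : Fin D → ℤ => v j' * ‖∑' j : Fin D → ℤ, m j' j * x j‖) ∧
        (∑' j' : Fin D → ℤ, v j' * ‖∑' j : Fin D → ℤ, m j' j * x j‖) ≤ ε := by
    intro ε hε
    have hu1 : 0 < u - 1 := sub_pos.2 hu
    set κ := γ' * (u - 1) ^ β' with hκ_def
    have hκ : 0 < κ := mul_pos hγ' (Real.rpow_pos_of_pos hu1 _)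
    set g : (Fin D → ℤ) → ℝ := fun n => C ^ 2 * C' *
      ((2 * ‖n‖ + 1) ^ D * Real.exp (2 * γ * ‖n‖ ^ β - κ * ‖n‖ ^ β')) with hg_def
    have hg : Summable g :=
      (summable_pow_mul_exp_sub_rpow hβ hββ' hκ (2 * γ) D).mul_left _
    have hg0 : ∀ n, 0 ≤ g n := fun n => by positivity
    have hev := (hg.tendsto_tsum_ite_le (fun n => ‖n‖)).eventually_lt_const hε
    obtain ⟨N, hNε, hNK⟩ := (hev.and
      (tendsto_natCast_atTop_atTop.eventually_gt_atTop (K₀ / (u - 1)))).exists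
    rw [div_lt_iff₀ hu1] at hNK
    have hN : 0 < N := by
      rcases Nat.eq_zero_or_pos N with h | h
      · subst h; simp at hNK; linarith
      · exact h
    obtain ⟨M, rfl⟩ : ∃ M, N = M + 1 := ⟨N - 1, by omega⟩
    obtain ⟨z, hz, hzs, hzt⟩ := exists_ne_zero_sum_mul_eq_zero_s7 m (intBox D M)
      (intBox D (M + 1 : ℕ)) (by
        rw [card_intBox, card_intBox]
        exact Nat.pow_lt_pow_left (by omega) (by omega))
    obtain ⟨a, ha, j₀, -, hj₀⟩ := exists_smul_norm_le_weight v hv0 _ z hz hzs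
    have hsum : ∀ j', ∑' j, m j' j * (a * z j) = a * ∑ j ∈ intBox D (M + 1 : ℕ), m j' j * z j := by
      intro j'
      rw [tsum_eq_sum (s := intBox D (M + 1 : ℕ)) (fun j hj => by simp [hzs j hj]),
        Finset.mul_sum]
      exact Finset.sum_congr rfl fun j _ => by ring
    have hbound : ∀ j', v j' * ‖∑' j, m j' j * (a * z j)‖ ≤
        if ((M + 1 : ℕ) : ℝ) ≤ ‖j'‖ then g j' else 0 := by
      intro j'
      split_ifs with hj'
      · have hentry : ∀ j ∈ intBox D (M + 1 : ℕ), ‖m j' j * (a * z j)‖ ≤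
            C' * Real.exp (-κ * ‖j'‖ ^ β') * v j' := by
          intro j hj
          have hjN := (mem_intBox.1 hj).trans hj'
          have hlow : (u - 1) * ‖j'‖ ≤ u * ‖j'‖ - ‖j‖ := by linarith
          have hvj : v j ≤ v j' := by
            rw [hv, hv]
            gcongr
          have hmj : ‖m j' j‖ ≤ C' * Real.exp (-κ * ‖j'‖ ^ β') := by
            refine (hm j' j ?_).trans ?_
            · nlinarith [mul_le_mul_of_nonneg_right hj' hu1.le]
            · have hpow : (u - 1) ^ β' * ‖j'‖ ^ β' ≤ (u * ‖j'‖ - ‖j‖) ^ β' := by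
                rw [← Real.mul_rpow hu1.le (norm_nonneg _)]
                exact Real.rpow_le_rpow (by positivity) hlow (hβ.trans hββ').le
              refine mul_le_mul_of_nonneg_left (Real.exp_le_exp.2 ?_) hC'.le
              rw [hκ_def]
              nlinarith [mul_le_mul_of_nonneg_left hpow hγ'.le]
          rw [norm_mul]
          exact mul_le_mul hmj ((ha j).trans hvj) (norm_nonneg _) (by positivity)
        have hrow : ‖∑' j, m j' j * (a * z j)‖ ≤
            (2 * ‖j'‖ + 1) ^ D * (C' * Real.exp (-κ * ‖j'‖ ^ β') * v j') := by
          rw [tsum_eq_sum (s := intBox D (M + 1 : ℕ)) (fun j hj => by simp [hzs j hj])]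
          refine (norm_sum_le_of_le _ hentry).trans ?_
          rw [Finset.sum_const, nsmul_eq_mul, card_intBox]
          have := (hv0 j').le
          push_cast at hj' ⊢
          gcongr
        refine (mul_le_mul_of_nonneg_left hrow (hv0 j').le).trans_eq ?_
        have hexp : Real.exp (2 * γ * ‖j'‖ ^ β - κ * ‖j'‖ ^ β') =
            Real.exp (γ * ‖j'‖ ^ β) * Real.exp (γ * ‖j'‖ ^ β) *
              Real.exp (-κ * ‖j'‖ ^ β') := by
          rw [← Real.exp_add, ← Real.exp_add]; congr 1; ring
        rw [hg_def, hv]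
        simp only [hexp]
        ring
      · have hmem : j' ∈ intBox D M := by
          rw [intBox, Finset.mem_Icc, Pi.le_def, Pi.le_def, ← forall_and]
          intro i
          have hlt : ‖j' i‖ < ((M + 1 : ℕ) : ℝ) := (norm_le_pi_norm j' i).trans_lt (not_le.1 hj')
          rw [Int.norm_eq_abs] at hlt
          have hlt' : |j' i| < ((M + 1 : ℕ) : ℤ) := by exact_mod_cast hlt
          rw [← abs_le]
          omega
        rw [hsum, hzt j' hmem]
        simp
    have htail : Summable fun j' => if ((M + 1 : ℕ) : ℝ) ≤ ‖j'‖ then g j' else 0 :=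
      hg.of_nonneg_of_le (fun j' => by split_ifs <;> simp [hg0])
        (fun j' => by split_ifs <;> simp [hg0])
    have hsummable := htail.of_nonneg_of_le
      (fun j' => mul_nonneg (hv0 j').le (norm_nonneg _)) hbound
    refine ⟨fun j => a * z j, (intBox D (M + 1 : ℕ)).finite_toSet.subset fun j hj => ?_,
      ha, ⟨j₀, hj₀⟩, hsummable, (hsummable.tsum_le_tsum hbound htail).trans hNε.le⟩
    by_contra h
    exact hj (by simp [hzs j h])
  refine ⟨main, ?_⟩
  rintro ⟨c, hc, hlow⟩
  obtain ⟨x, hfin, hle, ⟨j₀, hj₀⟩, -, hx⟩ := main (c / 2) (half_pos hc)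
  have hbdd : BddAbove (Set.range fun j => ‖x j‖ / v j) := by
    refine ⟨1, ?_⟩
    rintro _ ⟨j, rfl⟩
    exact (div_le_one (hv0 j)).2 (hle j)
  have hsup : 1 ≤ ⨆ j, ‖x j‖ / v j := by
    refine le_trans (le_of_eq ?_) (le_ciSup hbdd j₀)
    simp only [hj₀]
    exact (div_self (hv0 j₀).ne').symm
  nlinarith [hlow x hfin, mul_le_mul_of_nonneg_left hsup hc.le]
end

section
/- Let D ≥ 1 be an integer and let γ, γ̃ > 0 and 0 < β < β̃. For K₁ ∈ ℕ define A(K₁) = e^{γ K₁^β} · Σ_{K ≥ K₁} K^{D−1} e^{γ K^β} · (Σ_{k ≥ K} k^{D−1} e^{−γ̃ k^{β̃}}). Then all the series involved converge, and A(K₁) → 0 as K₁ → ∞. -/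
open Real Filter

theorem summable_pow_mul_exp_neg_mul_rpow (n : ℕ) {c b : ℝ} (hc : 0 < c) (hb : 0 < b) :
    Summable (fun k : ℕ => (k : ℝ) ^ n * Real.exp (-c * (k : ℝ) ^ b)) := by
  have h1 : (fun k : ℕ => Real.exp (-c * (k : ℝ) ^ b)) =o[atTop]
      fun k : ℕ => ((k : ℝ) ^ b) ^ (-((n : ℝ) + 2) / b) :=
    (isLittleO_exp_neg_mul_rpow_atTop hc _).comp_tendsto
      ((tendsto_rpow_atTop hb).comp tendsto_natCast_atTop_atTop)
  have h2 := (Asymptotics.isBigO_refl (fun k : ℕ => (k : ℝ) ^ n) atTop).mul h1.isBigO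
  refine summable_of_isBigO_nat (Real.summable_nat_rpow.2 (by norm_num : (-2 : ℝ) < -1))
    (h2.congr' EventuallyEq.rfl ?_)
  filter_upwards [eventually_gt_atTop 0] with k hk
  have hk' : (0 : ℝ) < k := by exact_mod_cast hk
  rw [← Real.rpow_mul hk'.le, ← Real.rpow_natCast, ← Real.rpow_add hk']
  congr 1
  field_simp
  ring

theorem summable_pow_mul_exp_neg_mul_rpow_mul_exp (n : ℕ) {c b b' : ℝ} (s : ℝ) (hc : 0 < c)
    (hb : 0 < b) (hbb' : b < b') :
    Summable (fun k : ℕ =>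
      (k : ℝ) ^ n * Real.exp (-c * (k : ℝ) ^ b') * Real.exp (s * (k : ℝ) ^ b)) := by
  refine Summable.of_norm_bounded_eventually_nat
    (summable_pow_mul_exp_neg_mul_rpow n (half_pos hc) (hb.trans hbb')) ?_
  have h : Tendsto (fun k : ℕ => (k : ℝ) ^ (b' - b)) atTop atTop :=
    (tendsto_rpow_atTop (sub_pos.2 hbb')).comp tendsto_natCast_atTop_atTop
  filter_upwards [h.eventually_ge_atTop (s / (c / 2)), eventually_gt_atTop 0] with k hk hk0
  have hk' : (0 : ℝ) < k := by exact_mod_cast hk0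
  rw [Real.norm_of_nonneg (by positivity), mul_assoc, ← Real.exp_add]
  gcongr
  have h1 : (k : ℝ) ^ b' = (k : ℝ) ^ (b' - b) * (k : ℝ) ^ b := by
    rw [← Real.rpow_add hk', sub_add_cancel]
  rw [div_le_iff₀ (half_pos hc)] at hk
  have h2 := mul_le_mul_of_nonneg_right hk (Real.rpow_nonneg hk'.le b)
  rw [h1]
  linarith

theorem summable_ite_le {f : ℕ → ℝ} (hf : Summable f) (K : ℕ) :
    Summable (fun k => if K ≤ k then f k else 0) := by
  refine (hf.indicator (Set.Ici K)).congr fun k => ?_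
  simp [Set.indicator_apply]

theorem tsum_ite_le_mul_le {f w : ℕ → ℝ} (hf : ∀ k, 0 ≤ f k) (hw : ∀ k, 0 ≤ w k)
    (hmono : Monotone w) (hs : Summable f) (hsw : Summable fun k => f k * w k) (K : ℕ) :
    (∑' k, if K ≤ k then f k else 0) * w K ≤ ∑' k, f k * w k := by
  rw [← tsum_mul_right]
  refine ((summable_ite_le hs K).mul_right _).tsum_le_tsum (fun k => ?_) hsw
  split_ifs with h
  · exact mul_le_mul_of_nonneg_left (hmono h) (hf k)
  · rw [zero_mul]
    exact mul_nonneg (hf k) (hw k)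

/-- **The double-series bound `A(K₁) → 0`** (equation (DoubleSumW) in the proof of
Theorem 4.13 of the paper).  For `0 < β < β̃` and `γ, γ̃ > 0`, the quantity
`A(K₁) = e^{γK₁^β}·Σ_{K ≥ K₁} K^{D−1} e^{γK^β}·(Σ_{k ≥ K} k^{D−1} e^{−γ̃k^β̃})`
is well defined (all series converge) and tends to `0` as `K₁ → ∞`. -/
theorem stmt8 (D : ℕ) (hD : 1 ≤ D) (γ γ' β β' : ℝ)
    (hγ : 0 < γ) (hγ' : 0 < γ') (hβ : 0 < β) (hββ' : β < β') :
    (∀ K : ℕ, Summable (fun k : ℕ =>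
        if K ≤ k then (k : ℝ) ^ (D - 1) * Real.exp (-γ' * (k : ℝ) ^ β') else 0)) ∧
    (∀ K₁ : ℕ, Summable (fun K : ℕ =>
        if K₁ ≤ K then
          (K : ℝ) ^ (D - 1) * Real.exp (γ * (K : ℝ) ^ β) *
            (∑' k : ℕ, if K ≤ k then (k : ℝ) ^ (D - 1) * Real.exp (-γ' * (k : ℝ) ^ β') else 0)
        else 0)) ∧
    Tendsto (fun K₁ : ℕ =>
        Real.exp (γ * (K₁ : ℝ) ^ β) *
          ∑' K : ℕ,
            if K₁ ≤ K then
              (K : ℝ) ^ (D - 1) * Real.exp (γ * (K : ℝ) ^ β) *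
                (∑' k : ℕ, if K ≤ k then (k : ℝ) ^ (D - 1) * Real.exp (-γ' * (k : ℝ) ^ β') else 0)
            else 0)
      atTop (nhds 0) := by
  have hmono : ∀ s : ℝ, 0 ≤ s → Monotone fun k : ℕ => Real.exp (s * (k : ℝ) ^ β) := by
    intro s hs k l hkl
    dsimp only
    gcongr
  have hf := summable_pow_mul_exp_neg_mul_rpow (D - 1) hγ' (hβ.trans hββ')
  have hfw := summable_pow_mul_exp_neg_mul_rpow_mul_exp (D - 1) (3 * γ) hγ' hβ hββ'
  set T : ℕ → ℝ := fun K =>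
    ∑' k : ℕ, if K ≤ k then (k : ℝ) ^ (D - 1) * Real.exp (-γ' * (k : ℝ) ^ β') else 0
  have hT0 : ∀ K, 0 ≤ T K := fun K => tsum_nonneg fun k => by split_ifs <;> positivity
  set C : ℝ := ∑' k : ℕ,
    (k : ℝ) ^ (D - 1) * Real.exp (-γ' * (k : ℝ) ^ β') * Real.exp (3 * γ * (k : ℝ) ^ β)
  have hTC : ∀ K, T K * Real.exp (3 * γ * (K : ℝ) ^ β) ≤ C := fun K =>
    tsum_ite_le_mul_le (fun k => by positivity) (fun k => by positivity)
      (hmono _ (by positivity)) hf hfw K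
  have hbound : Summable fun K : ℕ => C * ((K : ℝ) ^ (D - 1) * Real.exp (-γ * (K : ℝ) ^ β)) :=
    (summable_pow_mul_exp_neg_mul_rpow (D - 1) hγ hβ).mul_left C
  have hle : ∀ K : ℕ, Real.exp (γ * (K : ℝ) ^ β) *
      ((K : ℝ) ^ (D - 1) * Real.exp (γ * (K : ℝ) ^ β) * T K) ≤
      C * ((K : ℝ) ^ (D - 1) * Real.exp (-γ * (K : ℝ) ^ β)) := by
    intro K
    have hexp : Real.exp (3 * γ * (K : ℝ) ^ β) * Real.exp (-γ * (K : ℝ) ^ β) =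
        Real.exp (γ * (K : ℝ) ^ β) * Real.exp (γ * (K : ℝ) ^ β) := by
      rw [← Real.exp_add, ← Real.exp_add]
      ring_nf
    calc _ = T K * (Real.exp (γ * (K : ℝ) ^ β) * Real.exp (γ * (K : ℝ) ^ β)) *
          (K : ℝ) ^ (D - 1) := by ring
      _ = T K * Real.exp (3 * γ * (K : ℝ) ^ β) *
          ((K : ℝ) ^ (D - 1) * Real.exp (-γ * (K : ℝ) ^ β)) := by rw [← hexp]; ring
      _ ≤ _ := mul_le_mul_of_nonneg_right (hTC K) (by positivity)
  have hterm0 : ∀ K : ℕ, 0 ≤ (K : ℝ) ^ (D - 1) * Real.exp (γ * (K : ℝ) ^ β) * T K := fun K =>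
    mul_nonneg (by positivity) (hT0 K)
  refine ⟨summable_ite_le hf, summable_ite_le (Summable.of_nonneg_of_le hterm0 (fun K => ?_)
    hbound), ?_⟩
  · exact (le_mul_of_one_le_left (hterm0 K) (Real.one_le_exp (by positivity))).trans (hle K)
  · change Tendsto (fun K₁ : ℕ => Real.exp (γ * (K₁ : ℝ) ^ β) * ∑' K : ℕ,
      if K₁ ≤ K then (K : ℝ) ^ (D - 1) * Real.exp (γ * (K : ℝ) ^ β) * T K else 0) atTop (nhds 0)
    rw [show nhds (0 : ℝ) = nhds (∑' _ : ℕ, (0 : ℝ)) by rw [tsum_zero]]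
    refine Tendsto.congr (fun K₁ => tsum_mul_left) ?_
    refine tendsto_tsum_of_dominated_convergence hbound (fun K => ?_)
      (Eventually.of_forall fun K₁ K => ?_)
    · refine tendsto_const_nhds.congr' ?_
      filter_upwards [eventually_gt_atTop K] with K₁ h
      rw [if_neg (not_le.2 h), mul_zero]
    · split_ifs with h
      · rw [Real.norm_of_nonneg (mul_nonneg (Real.exp_nonneg _) (hterm0 K))]
        exact (mul_le_mul_of_nonneg_right (hmono γ hγ.le h) (hterm0 K)).trans (hle K)
      · rw [mul_zero, norm_zero]
        exact (mul_nonneg (Real.exp_nonneg _) (hterm0 K)).trans (hle K)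
end

section
/- Let d ≥ 1, let f, g be Schwartz functions on ℝ^d, and let 𝔤(x) = 2^{d/4}·e^{−π‖x‖₂²} be the normalized Gaussian. Define the short-time Fourier transform V_𝔤 h(a, b) = ∫_{ℝ^d} h(s)·𝔤(s − a)·e^{−2πi s·b} ds for h Schwartz and a, b ∈ ℝ^d. Then for all x, t, ν, ξ ∈ ℝ^d, ∫_{ℝ^d} ∫_{ℝ^d} g(x')·conj(f(x' − t'))·e^{−2πi(x'·ν + t'·ξ)}·𝔤(x' − x)·𝔤(x' − x − t' + t) dt' dx' = V_𝔤 g(x, ν + ξ) · conj(V_𝔤 f(x − t, ξ)). -/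
open MeasureTheory Real SchwartzMap RealInnerProductSpace

/-- **STFT factorization identity** (key computation in the proof of Lemma 2.7 of
the paper).  With `𝔤` the normalized Gaussian on `ℝ^d` and
`V_𝔤 h(a,b) = ∫ h(s)·𝔤(s−a)·e^{−2πi⟨s,b⟩} ds`, for Schwartz `f, g`:
`∫∫ g(x')·conj(f(x'−t'))·e^{−2πi(⟨x',ν⟩+⟨t',ξ⟩)}·𝔤(x'−x)·𝔤(x'−x−t'+t) dt' dx'
  = V_𝔤 g(x, ν+ξ)·conj(V_𝔤 f(x−t, ξ))`. -/
theorem stmt10 (d : ℕ) (hd : 1 ≤ d)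
    (f g : 𝓢(EuclideanSpace ℝ (Fin d), ℂ))
    (gauss : EuclideanSpace ℝ (Fin d) → ℂ)
    (hgauss : ∀ x, gauss x = (((2 : ℝ) ^ ((d : ℝ) / 4) * Real.exp (-π * ‖x‖ ^ 2) : ℝ) : ℂ))
    (V : (EuclideanSpace ℝ (Fin d) → ℂ) →
          EuclideanSpace ℝ (Fin d) → EuclideanSpace ℝ (Fin d) → ℂ)
    (hV : ∀ (h : EuclideanSpace ℝ (Fin d) → ℂ) (a b : EuclideanSpace ℝ (Fin d)),
      V h a b = ∫ s, h s * gauss (s - a) *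
        Complex.exp (-(2 * π * Complex.I) * ((⟪s, b⟫ : ℝ) : ℂ))) :
    ∀ x t ν ξ : EuclideanSpace ℝ (Fin d),
      (∫ x', ∫ t', g x' * (starRingEnd ℂ) (f (x' - t')) *
          Complex.exp (-(2 * π * Complex.I) * (((⟪x', ν⟫ + ⟪t', ξ⟫ : ℝ)) : ℂ)) *
          gauss (x' - x) * gauss (x' - x - t' + t))
        = V (⇑g) x (ν + ξ) * (starRingEnd ℂ) (V (⇑f) (x - t) ξ) := by
  intro x t ν ξ
  have conj_gauss (y : EuclideanSpace ℝ (Fin d)) : (starRingEnd ℂ) (gauss y) = gauss y := by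
    rw [hgauss, Complex.conj_ofReal]
  have inner_integral (x' : EuclideanSpace ℝ (Fin d)) :
      (∫ t', g x' * (starRingEnd ℂ) (f (x' - t')) *
          Complex.exp (-(2 * π * Complex.I) * (((⟪x', ν⟫ + ⟪t', ξ⟫ : ℝ)) : ℂ)) *
          gauss (x' - x) * gauss (x' - x - t' + t))
        = g x' * gauss (x' - x) *
            Complex.exp (-(2 * π * Complex.I) * ((⟪x', ν + ξ⟫ : ℝ) : ℂ)) *
          (starRingEnd ℂ) (V (⇑f) (x - t) ξ) := by
    rw [hV, ← integral_conj, ← integral_const_mul, ← integral_sub_left_eq_self _ volume x']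
    refine integral_congr_ae (.of_forall fun s => ?_)
    have exp_split :
        Complex.exp (-(2 * π * Complex.I) * (((⟪x', ν⟫ + ⟪x' - s, ξ⟫ : ℝ)) : ℂ)) =
          Complex.exp (-(2 * π * Complex.I) * ((⟪x', ν + ξ⟫ : ℝ) : ℂ)) *
            (starRingEnd ℂ)
              (Complex.exp (-(2 * π * Complex.I) * ((⟪s, ξ⟫ : ℝ) : ℂ))) := by
      rw [← Complex.exp_conj, ← Complex.exp_add]
      congr 1
      simp only [map_mul, map_neg, Complex.conj_I, Complex.conj_ofReal, Complex.conj_ofNat,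
        inner_add_right, inner_sub_left]
      push_cast
      ring
    have shift : x' - x - (x' - s) + t = s - (x - t) := by abel
    simp only [map_mul, conj_gauss, sub_sub_cancel, exp_split, shift]
    ring
  simp only [inner_integral]
  rw [integral_mul_const, hV (⇑g)]
end

section
/- Let h be a Schwartz function on ℝ², let T > 0, and define η(t, ν) = ∫_ℝ h(x, t)·e^{−2πiνx} dx. Then for all t, ν ∈ ℝ, both of the following double series converge absolutely and Σ_{m∈ℤ} Σ_{k∈ℤ} h(t − mT, t − mT − kT)·e^{2πi m T ν} = (1/T)·Σ_{m∈ℤ} Σ_{l∈ℤ} η(t − mT, ν − l/T)·e^{2πi t (ν − l/T)}. -/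
open MeasureTheory Real SchwartzMap

open scoped FourierTransform LineDeriv

lemma summable_inv_one_add_sub_mul_sq (a : ℝ) {T : ℝ} (hT : T ≠ 0) :
    Summable fun n : ℤ => (1 + (a - n * T) ^ 2)⁻¹ := by
  have hs := ((Real.summable_one_div_int_add_rpow (1 / 2) 2).2 one_lt_two).mul_left
    (2 * (a / T + 1 / 2) ^ 2 + 2 / T ^ 2)
  refine Summable.of_nonneg_of_le (fun n => by positivity) (fun n => ?_) hs
  have hn : (n : ℝ) + 1 / 2 ≠ 0 := fun h0 => by
    have h1 : (2 * n + 1 : ℝ) = 0 := by linarith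
    have h2 : 2 * n + 1 = 0 := by exact_mod_cast h1
    omega
  have hpos : 0 < ((n : ℝ) + 1 / 2) ^ 2 := by positivity
  rw [Real.rpow_two, sq_abs, mul_one_div, le_div_iff₀ hpos, inv_mul_le_iff₀ (by positivity)]
  obtain ⟨y, hy⟩ : ∃ y, y = (a - n * T) := ⟨_, rfl⟩
  have hn' : (n : ℝ) = a / T - y / T := by rw [hy]; field_simp; ring
  rw [← hy, hn']
  have h1 : 2 / T ^ 2 * y ^ 2 = 2 * (y / T) ^ 2 := by ring
  have h2 : 0 ≤ y ^ 2 * (a / T + 1 / 2) ^ 2 := by positivity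
  have h3 : 0 ≤ 2 / T ^ 2 := by positivity
  nlinarith [sq_nonneg ((a / T + 1 / 2) + y / T)]

/-- Poisson summation over the lattice `Tℤ` for the function `x ↦ g x * exp (-2πiνx)`. -/
lemma tsum_modulated_eq_tsum_fourier {g : ℝ → ℂ} (hg : Continuous g) {C : ℝ}
    (hdecay : ∀ x, ‖g x‖ ≤ C * (1 + x ^ 2)⁻¹) {T : ℝ} (hT : 0 < T) (ν : ℝ)
    (hsum : Summable fun n : ℤ => 𝓕 g (ν + n / T)) (x : ℝ) :
    ∑' n : ℤ, g (x + n * T) * Complex.exp (-(2 * π * Complex.I) * ν * (x + n * T)) =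
      (1 / T) * ∑' n : ℤ, 𝓕 g (ν + n / T) * Complex.exp (2 * π * Complex.I * n * x / T) := by
  have hT' : (T : ℂ) ≠ 0 := by exact_mod_cast hT.ne'
  set f : ℝ → ℂ := fun u => g (T * u) * Complex.exp (-(2 * π * Complex.I) * ν * (T * u)) with hf
  have hfc : Continuous f := by fun_prop
  have hnorm (u : ℝ) : ‖f u‖ = ‖g (T * u)‖ := by
    have : -(2 * π * Complex.I) * ν * (T * u) = ((-(2 * π * ν * (T * u)) : ℝ) : ℂ) * Complex.I := by
      push_cast; ring
    rw [hf, norm_mul, this, Complex.norm_exp_ofReal_mul_I, mul_one]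
  have hF (w : ℝ) : 𝓕 f w = (1 / T) * 𝓕 g (ν + w / T) := by
    have := Measure.integral_comp_mul_left
      (fun v : ℝ => Complex.exp (↑(-2 * π * v * (ν + w / T)) * Complex.I) • g v) T
    rw [Real.fourier_real_eq_integral_exp_smul, Real.fourier_real_eq_integral_exp_smul]
    rw [abs_of_pos (inv_pos.2 hT)] at this
    rw [one_div, ← Complex.ofReal_inv, ← Complex.real_smul, ← this]
    congr 1
    ext v
    rw [hf, smul_eq_mul, smul_eq_mul, mul_left_comm, ← Complex.exp_add, mul_comm]
    congr 2
    push_cast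
    field_simp
    ring
  have hC : 0 ≤ C := by simpa using (norm_nonneg _).trans (hdecay 0)
  have hO : f =O[Filter.cocompact ℝ] fun u : ℝ => |u| ^ (-2 : ℝ) := by
    refine Asymptotics.IsBigO.of_bound (C / T ^ 2) ?_
    have h0 : ∀ᶠ u : ℝ in Filter.cocompact ℝ, u ≠ 0 :=
      Filter.cocompact_le_cofinite (Set.finite_singleton 0).compl_mem_cofinite
    filter_upwards [h0] with u hu
    rw [hnorm, Real.rpow_neg (abs_nonneg u), Real.rpow_two, sq_abs,
      Real.norm_of_nonneg (by positivity)]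
    refine (hdecay _).trans ?_
    rw [div_mul_eq_mul_div, mul_div_assoc]
    gcongr
    rw [div_eq_mul_inv, ← mul_inv]
    gcongr
    nlinarith
  have hsf : Summable fun n : ℤ => 𝓕 f n := by
    simp only [hF]
    exact hsum.mul_left _
  have key := Real.tsum_eq_tsum_fourier_of_rpow_decay_of_summable hfc one_lt_two hO hsf (x / T)
  rw [← tsum_mul_left]
  convert key using 1
  · congr 1 with n
    have hx : T * (x / T + n) = x + n * T := by field_simp
    simp only [hf, hx]
    congr 2
    push_cast
    field_simp
  · congr 1 with n
    rw [hF, fourier_coe_apply, Complex.ofReal_div, Complex.ofReal_one, div_one,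
      mul_assoc (1 / (T : ℂ)), mul_div_assoc]

namespace SchwartzMap

lemma exists_norm_le_inv_one_add_sq_mul (h : 𝓢(ℝ × ℝ, ℂ)) :
    ∃ C : ℝ, 0 ≤ C ∧ ∀ x s : ℝ, ‖h (x, s)‖ ≤ C * (1 + s ^ 2)⁻¹ * (1 + x ^ 2)⁻¹ := by
  obtain ⟨C₀, hC₀, h₀⟩ := h.decay 0 0
  obtain ⟨C₂, hC₂, h₂⟩ := h.decay 2 0
  obtain ⟨C₄, hC₄, h₄⟩ := h.decay 4 0
  refine ⟨C₀ + 2 * C₂ + C₄, by positivity, fun x s => ?_⟩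
  have h₀ := h₀ (x, s)
  have h₂ := h₂ (x, s)
  have h₄ := h₄ (x, s)
  simp only [norm_iteratedFDeriv_zero] at h₀ h₂ h₄
  have hx : x ^ 2 ≤ ‖(x, s)‖ ^ 2 := by
    rw [← sq_abs]; gcongr; exact norm_fst_le (x, s)
  have hs : s ^ 2 ≤ ‖(x, s)‖ ^ 2 := by
    rw [← sq_abs]; gcongr; exact norm_snd_le (x, s)
  rw [mul_assoc, ← mul_inv, ← div_eq_mul_inv, le_div_iff₀ (by positivity)]
  calc ‖h (x, s)‖ * ((1 + s ^ 2) * (1 + x ^ 2))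
      ≤ ‖h (x, s)‖ * ((1 + ‖(x, s)‖ ^ 2) * (1 + ‖(x, s)‖ ^ 2)) := by gcongr
    _ ≤ C₀ + 2 * C₂ + C₄ := by linarith

lemma integrable_slice (h : 𝓢(ℝ × ℝ, ℂ)) (s : ℝ) : Integrable fun x => h (x, s) := by
  obtain ⟨C, -, hC⟩ := h.exists_norm_le_inv_one_add_sq_mul
  exact (integrable_inv_one_add_sq.const_mul _).mono'
    (by fun_prop : Continuous fun x => h (x, s)).aestronglyMeasurable
    (Filter.Eventually.of_forall fun x => hC x s)

lemma hasDerivAt_slice (h : 𝓢(ℝ × ℝ, ℂ)) (s x : ℝ) :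
    HasDerivAt (fun x => h (x, s)) ((∂_{((1 : ℝ), (0 : ℝ))} h : 𝓢(ℝ × ℝ, ℂ)) (x, s)) x := by
  rw [lineDerivOp_apply_eq_fderiv]
  exact (h.hasFDerivAt (x, s)).comp_hasDerivAt x ((hasDerivAt_id x).prodMk (hasDerivAt_const x s))

lemma fourier_slice_lineDeriv (h : 𝓢(ℝ × ℝ, ℂ)) (s w : ℝ) :
    𝓕 (fun x => (∂_{((1 : ℝ), (0 : ℝ))} h : 𝓢(ℝ × ℝ, ℂ)) (x, s)) w =
      (2 * π * Complex.I * w) * 𝓕 (fun x => h (x, s)) w := by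
  have hd : deriv (fun x => h (x, s)) =
      fun x => (∂_{((1 : ℝ), (0 : ℝ))} h : 𝓢(ℝ × ℝ, ℂ)) (x, s) :=
    funext fun x => (h.hasDerivAt_slice s x).deriv
  have := Real.fourier_deriv (h.integrable_slice s)
    (fun x => (h.hasDerivAt_slice s x).differentiableAt) (hd ▸ integrable_slice _ s)
  rw [← hd, this]
  rfl

lemma exists_norm_fourier_slice_le (h : 𝓢(ℝ × ℝ, ℂ)) :
    ∃ C : ℝ, 0 ≤ C ∧ ∀ s w : ℝ, ‖𝓕 (fun x => h (x, s)) w‖ ≤ C * (1 + s ^ 2)⁻¹ := by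
  obtain ⟨C, hC₀, hC⟩ := h.exists_norm_le_inv_one_add_sq_mul
  refine ⟨C * π, by positivity, fun s w => ?_⟩
  calc ‖𝓕 (fun x => h (x, s)) w‖ ≤ ∫ x, ‖h (x, s)‖ :=
        VectorFourier.norm_fourierIntegral_le_integral_norm _ _ _ _ _
    _ ≤ ∫ x : ℝ, C * (1 + s ^ 2)⁻¹ * (1 + x ^ 2)⁻¹ :=
        integral_mono (h.integrable_slice s).norm (integrable_inv_one_add_sq.const_mul _)
          fun x => hC x s
    _ = C * π * (1 + s ^ 2)⁻¹ := by
        rw [integral_const_mul, integral_univ_inv_one_add_sq]; ring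

lemma exists_norm_fourier_slice_le_mul (h : 𝓢(ℝ × ℝ, ℂ)) :
    ∃ C : ℝ, 0 ≤ C ∧ ∀ s w : ℝ,
      ‖𝓕 (fun x => h (x, s)) w‖ ≤ C * (1 + s ^ 2)⁻¹ * (1 + w ^ 2)⁻¹ := by
  obtain ⟨C, hC₀, hC⟩ := h.exists_norm_fourier_slice_le
  obtain ⟨D, hD₀, hD⟩ := exists_norm_fourier_slice_le
    (∂_{((1 : ℝ), (0 : ℝ))} (∂_{((1 : ℝ), (0 : ℝ))} h : 𝓢(ℝ × ℝ, ℂ)) : 𝓢(ℝ × ℝ, ℂ))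
  refine ⟨C + D, by positivity, fun s w => ?_⟩
  have h₁ := hC s w
  have h₂ := hD s w
  simp only [fourier_slice_lineDeriv, norm_mul, Complex.norm_I, Complex.norm_real,
    Real.norm_of_nonneg Real.pi_pos.le, Complex.norm_ofNat, mul_one, Real.norm_eq_abs] at h₂
  rw [← div_eq_mul_inv _ (1 + w ^ 2), le_div_iff₀ (by positivity)]
  have h₃ : w ^ 2 * ‖𝓕 (fun x => h (x, s)) w‖ ≤
      2 * π * |w| * (2 * π * |w| * ‖𝓕 (fun x => h (x, s)) w‖) := by
    have : 2 * π * |w| * (2 * π * |w| * ‖𝓕 (fun x => h (x, s)) w‖) =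
        (2 * π) ^ 2 * (w ^ 2 * ‖𝓕 (fun x => h (x, s)) w‖) := by rw [← sq_abs w]; ring
    rw [this]
    exact le_mul_of_one_le_left (by positivity) (by nlinarith [Real.pi_gt_three])
  linarith

end SchwartzMap

/-- **Zak-transform / Poisson-summation identity** (from the proof of Theorem 3.4 of
the paper).  For Schwartz `h` on `ℝ²`, spreading function
`η(t,ν) = ∫ h(x,t)e^{−2πiνx} dx`, and `T > 0`:
`Σ_m Σ_k h(t−mT, t−mT−kT)·e^{2πimTν} = (1/T)·Σ_m Σ_l η(t−mT, ν−l/T)·e^{2πit(ν−l/T)}`,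
both double series converging absolutely. -/
theorem stmt11 (h : 𝓢(ℝ × ℝ, ℂ)) (T : ℝ) (hT : 0 < T)
    (η : ℝ → ℝ → ℂ)
    (hη : ∀ t ν : ℝ, η t ν = ∫ x : ℝ, h (x, t) * Complex.exp (-(2 * π * Complex.I) * ν * x)) :
    ∀ t ν : ℝ,
      Summable (fun p : ℤ × ℤ =>
        ‖h (t - (p.1 : ℝ) * T, t - (p.1 : ℝ) * T - (p.2 : ℝ) * T) *
          Complex.exp (2 * π * Complex.I * (p.1 : ℝ) * T * ν)‖) ∧
      Summable (fun p : ℤ × ℤ =>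
        ‖η (t - (p.1 : ℝ) * T) (ν - (p.2 : ℝ) / T) *
          Complex.exp (2 * π * Complex.I * t * (ν - (p.2 : ℝ) / T))‖) ∧
      (∑' m : ℤ, ∑' k : ℤ,
          h (t - (m : ℝ) * T, t - (m : ℝ) * T - (k : ℝ) * T) *
            Complex.exp (2 * π * Complex.I * (m : ℝ) * T * ν))
        = (1 / T) * ∑' m : ℤ, ∑' l : ℤ,
            η (t - (m : ℝ) * T) (ν - (l : ℝ) / T) *
              Complex.exp (2 * π * Complex.I * t * (ν - (l : ℝ) / T)) := by
  have hexp (z : ℝ) : ‖Complex.exp (z * Complex.I)‖ = 1 := Complex.norm_exp_ofReal_mul_I z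
  have hηF (s w : ℝ) : η s w = 𝓕 (fun x => h (x, s)) w := by
    rw [hη, Real.fourier_real_eq_integral_exp_smul]
    congr 1 with x
    rw [smul_eq_mul, mul_comm]
    congr 2
    push_cast
    ring
  obtain ⟨C, hC₀, hC⟩ := h.exists_norm_le_inv_one_add_sq_mul
  obtain ⟨D, hD₀, hD⟩ := h.exists_norm_fourier_slice_le_mul
  intro t ν
  have hsT := summable_inv_one_add_sub_mul_sq t hT.ne'
  have hsν := summable_inv_one_add_sub_mul_sq ν (inv_ne_zero hT.ne')
  set Q : ℤ → ℤ → ℂ := fun m n => h (t - (m : ℝ) * T, t - (n : ℝ) * T) *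
    Complex.exp (2 * π * Complex.I * (m : ℝ) * T * ν) with hQdef
  have hQ : Summable fun p : ℤ × ℤ => ‖Q p.1 p.2‖ := by
    refine Summable.of_nonneg_of_le (fun p => norm_nonneg _) (fun p => ?_)
      ((hsT.mul_of_nonneg hsT (fun _ => by positivity) (fun _ => by positivity)).mul_left C)
    have : (2 * π * Complex.I * (p.1 : ℝ) * T * ν : ℂ) =
        ((2 * π * p.1 * T * ν : ℝ) : ℂ) * Complex.I := by push_cast; ring
    rw [hQdef, norm_mul, this, hexp, mul_one]
    exact (hC _ _).trans_eq (by ring)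
  have hη_sum : Summable fun p : ℤ × ℤ =>
      ‖η (t - (p.1 : ℝ) * T) (ν - (p.2 : ℝ) / T) *
        Complex.exp (2 * π * Complex.I * t * (ν - (p.2 : ℝ) / T))‖ := by
    refine Summable.of_nonneg_of_le (fun p => norm_nonneg _) (fun p => ?_)
      ((hsT.mul_of_nonneg hsν (fun _ => by positivity) (fun _ => by positivity)).mul_left D)
    have : (2 * π * Complex.I * t * (ν - (p.2 : ℝ) / T) : ℂ) =
        ((2 * π * t * (ν - p.2 / T) : ℝ) : ℂ) * Complex.I := by push_cast; ring
    rw [norm_mul, this, hexp, mul_one, hηF]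
    exact (hD _ _).trans_eq (by rw [div_eq_mul_inv]; ring)
  have hshift (m k : ℤ) : h (t - (m : ℝ) * T, t - (m : ℝ) * T - (k : ℝ) * T) *
      Complex.exp (2 * π * Complex.I * (m : ℝ) * T * ν) = Q m (m + k) := by
    simp only [hQdef]
    congr 3
    push_cast
    ring_nf
  simp only [hshift]
  refine ⟨((Equiv.prodShear (Equiv.refl ℤ) Equiv.addLeft).summable_iff).2 hQ, hη_sum, ?_⟩
  calc ∑' m : ℤ, ∑' k : ℤ, Q m (m + k) = ∑' m : ℤ, ∑' n : ℤ, Q m n :=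
        tsum_congr fun m => (Equiv.addLeft m).tsum_eq (Q m)
    _ = ∑' n : ℤ, ∑' m : ℤ, Q m n := (Summable.tsum_comm (f := Q) hQ.of_norm).symm
    _ = _ := by
      rw [← tsum_mul_left]
      refine tsum_congr fun n => ?_
      set s := t - (n : ℝ) * T
      have hsF : Summable fun l : ℤ => 𝓕 (fun x => h (x, s)) (ν + l / T) := by
        rw [← (Equiv.neg ℤ).summable_iff]
        refine Summable.of_norm_bounded (hsν.mul_left (D * (1 + s ^ 2)⁻¹)) fun l => ?_
        refine (hD s _).trans_eq ?_
        simp [div_eq_mul_inv, ← sub_eq_add_neg]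
      have key := tsum_modulated_eq_tsum_fourier (g := fun x => h (x, s)) (by fun_prop)
        (fun x => hC x s) hT ν hsF t
      rw [← (Equiv.neg ℤ).tsum_eq, ← (Equiv.neg ℤ).tsum_eq (fun l : ℤ =>
        𝓕 (fun x => h (x, s)) (ν + l / T) * Complex.exp (2 * π * Complex.I * l * t / T))] at key
      have key' := congrArg (Complex.exp (2 * π * Complex.I * t * ν) * ·) key
      simp only [mul_left_comm _ (1 / (T : ℂ)), ← tsum_mul_left] at key'
      convert key' using 1
      · refine tsum_congr fun m => ?_
        rw [mul_left_comm, ← Complex.exp_add]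
        simp only [hQdef, Equiv.neg_apply]
        congr 2
        · congr 2
          push_cast
          ring
        · push_cast
          ring
      · rw [tsum_mul_left]
        congr 1
        refine tsum_congr fun l => ?_
        rw [mul_left_comm, ← Complex.exp_add, hηF]
        simp only [Equiv.neg_apply, Int.cast_neg, neg_div, ← sub_eq_add_neg]
        congr 2
        push_cast
        ring_nf
end

section
/- Let 𝒫 ⊆ ℕ be unbounded and let M ⊆ ℝ² be bounded. Then vol⁻(M) = sup{μ(U) : U ∈ 𝒰_{K,L} for some K ∈ ℕ⁺ and some L ∈ 𝒫, U ⊆ M} and vol⁺(M) = inf{μ(U) : U ∈ 𝒰_{K,L} for some K ∈ ℕ⁺ and some L ∈ 𝒫, U ⊇ M}; that is, restricting the parameter L to range over 𝒫 yields the same inner and outer contents. -/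
open MeasureTheory

/-- The translated half-open rectangle `R_{K,L} + (k/K, p·K/L)`, where
`R_{K,L} = [0, 1/K) × [0, K/L)`. -/
def jordanCell (K L : ℕ+) (k p : ℤ) : Set (ℝ × ℝ) :=
  Set.Ico ((k : ℝ) / ((K : ℕ) : ℝ)) (((k : ℝ) + 1) / ((K : ℕ) : ℝ)) ×ˢ
    Set.Ico ((p : ℝ) * ((K : ℕ) : ℝ) / ((L : ℕ) : ℝ))
      (((p : ℝ) + 1) * ((K : ℕ) : ℝ) / ((L : ℕ) : ℝ))

/-- The collection `𝒰_{K,L}` of finite unions of translated rectangles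
`R_{K,L} + (k/K, p·K/L)`, `k, p ∈ ℤ`. -/
def UKL (K L : ℕ+) : Set (Set (ℝ × ℝ)) :=
  {U | ∃ F : Finset (ℤ × ℤ), U = ⋃ kp ∈ F, jordanCell K L kp.1 kp.2}

/-- The inner content `vol⁻(M) = sup{μ(U) : U ∈ 𝒰_{K,L}, K, L ∈ ℕ⁺, U ⊆ M}`. -/
noncomputable def volMinus (M : Set (ℝ × ℝ)) : ENNReal :=
  ⨆ (K : ℕ+) (L : ℕ+) (U : Set (ℝ × ℝ)) (_ : U ∈ UKL K L) (_ : U ⊆ M), volume U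

/-- The outer content `vol⁺(M) = inf{μ(U) : U ∈ 𝒰_{K,L}, K, L ∈ ℕ⁺, M ⊆ U}`. -/
noncomputable def volPlus (M : Set (ℝ × ℝ)) : ENNReal :=
  ⨅ (K : ℕ+) (L : ℕ+) (U : Set (ℝ × ℝ)) (_ : U ∈ UKL K L) (_ : M ⊆ U), volume U

/-- The vertical strip of width `1/K` over `[k/K, (k+1)/K)`, cut off to heights in `[s, t)`. -/
def stripRect (K : ℕ+) (k : ℤ) (s t : ℝ) : Set (ℝ × ℝ) :=
  Set.Ico ((k : ℝ) / ((K : ℕ) : ℝ)) (((k : ℝ) + 1) / ((K : ℕ) : ℝ)) ×ˢ Set.Ico s t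

lemma pnat_cast_pos (K : ℕ+) : (0 : ℝ) < ((K : ℕ) : ℝ) := by exact_mod_cast K.pos

lemma volume_stripRect (K : ℕ+) (k : ℤ) (s t : ℝ) :
    volume (stripRect K k s t) = ENNReal.ofReal ((t - s) / ((K : ℕ) : ℝ)) := by
  have hK := pnat_cast_pos K
  rw [stripRect, Measure.volume_eq_prod, Measure.prod_prod, Real.volume_Ico, Real.volume_Ico,
    ← ENNReal.ofReal_mul (by rw [← sub_div]; simp)]
  congr 1
  field_simp
  ring

lemma volume_stripRect_le {K L : ℕ+} (k : ℤ) {s t : ℝ}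
    (h : t - s ≤ ((K : ℕ) : ℝ) / ((L : ℕ) : ℝ)) :
    volume (stripRect K k s t) ≤ ENNReal.ofReal (1 / ((L : ℕ) : ℝ)) := by
  have hK := pnat_cast_pos K
  rw [volume_stripRect]
  apply ENNReal.ofReal_le_ofReal
  rw [div_le_iff₀ hK]
  calc t - s ≤ _ := h
    _ = _ := by ring

lemma biUnion_mem_UKL {ι : Type*} {K L : ℕ+} (F : Finset ι) (V : ι → Set (ℝ × ℝ))
    (hV : ∀ i ∈ F, V i ∈ UKL K L) : (⋃ i ∈ F, V i) ∈ UKL K L := by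
  classical
  induction F using Finset.induction_on with
  | empty => exact ⟨∅, by simp⟩
  | insert a F _ ih =>
    obtain ⟨A, hA⟩ := hV a (Finset.mem_insert_self a F)
    obtain ⟨B, hB⟩ := ih fun i hi => hV i (Finset.mem_insert_of_mem hi)
    refine ⟨A ∪ B, ?_⟩
    rw [Finset.set_biUnion_insert, Finset.set_biUnion_union, hB, hA]

lemma jordanCell_mem_UKL (K L : ℕ+) (k p : ℤ) : jordanCell K L k p ∈ UKL K L :=
  ⟨{(k, p)}, by simp⟩

lemma stripRect_mem_UKL (K L : ℕ+) (k a b : ℤ) :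
    stripRect K k ((a : ℝ) * ((K : ℕ) : ℝ) / ((L : ℕ) : ℝ))
      ((b : ℝ) * ((K : ℕ) : ℝ) / ((L : ℕ) : ℝ)) ∈ UKL K L := by
  have hK := pnat_cast_pos K
  have hL := pnat_cast_pos L
  convert biUnion_mem_UKL (Finset.Ico a b) (fun p => jordanCell K L k p)
    (fun p _ => jordanCell_mem_UKL K L k p)
  ext ⟨x, y⟩
  simp only [stripRect, jordanCell, Set.mem_prod, Set.mem_Ico, Set.mem_iUnion, Finset.mem_Ico,
    exists_prop, div_le_iff₀ hL, lt_div_iff₀ hL, ← le_div_iff₀ hK, ← div_lt_iff₀ hK]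
  constructor
  · rintro ⟨hx, h1, h2⟩
    exact ⟨⌊y * ((L : ℕ) : ℝ) / ((K : ℕ) : ℝ)⌋, ⟨Int.le_floor.2 h1, Int.floor_lt.2 h2⟩, hx,
      Int.floor_le _, Int.lt_floor_add_one _⟩
  · rintro ⟨p, ⟨h1, h2⟩, hx, h3, h4⟩
    have h1' : (a : ℝ) ≤ p := by exact_mod_cast h1
    have h2' : (p : ℝ) + 1 ≤ b := by exact_mod_cast h2
    exact ⟨hx, h1'.trans h3, h4.trans_le h2'⟩

lemma stripRect_diff_subset (K : ℕ+) (k : ℤ) (s t s' t' : ℝ) :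
    stripRect K k s t \ stripRect K k s' t' ⊆ stripRect K k s s' ∪ stripRect K k t' t := by
  rintro ⟨x, y⟩ ⟨⟨hx, h1, h2⟩, hn⟩
  rcases lt_or_ge y s' with h | h
  · exact Or.inl ⟨hx, h1, h⟩
  · exact Or.inr ⟨hx, not_lt.1 fun h' => hn ⟨hx, h, h'⟩, h2⟩

lemma volume_stripRect_diff_le {K L : ℕ+} (k : ℤ) {s t s' t' : ℝ}
    (hs : s' - s ≤ ((K : ℕ) : ℝ) / ((L : ℕ) : ℝ)) (ht : t - t' ≤ ((K : ℕ) : ℝ) / ((L : ℕ) : ℝ)) :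
    volume (stripRect K k s t \ stripRect K k s' t') ≤ ENNReal.ofReal (2 / ((L : ℕ) : ℝ)) := by
  have hL := pnat_cast_pos L
  calc _ ≤ volume (stripRect K k s s') + volume (stripRect K k t' t) :=
        (measure_mono (stripRect_diff_subset ..)).trans (measure_union_le _ _)
    _ ≤ ENNReal.ofReal (1 / ((L : ℕ) : ℝ)) + ENNReal.ofReal (1 / ((L : ℕ) : ℝ)) :=
        add_le_add (volume_stripRect_le k hs) (volume_stripRect_le k ht)
    _ = _ := by
        rw [← ENNReal.ofReal_add (by positivity) (by positivity)]
        congr 1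
        ring

lemma exists_grid_ge (K L : ℕ+) (s : ℝ) :
    ∃ a : ℤ, s ≤ (a : ℝ) * ((K : ℕ) : ℝ) / ((L : ℕ) : ℝ) ∧
      (a : ℝ) * ((K : ℕ) : ℝ) / ((L : ℕ) : ℝ) - s ≤ ((K : ℕ) : ℝ) / ((L : ℕ) : ℝ) := by
  have hK := pnat_cast_pos K
  have hL := pnat_cast_pos L
  refine ⟨⌈s * ((L : ℕ) : ℝ) / ((K : ℕ) : ℝ)⌉, ?_, ?_⟩
  · rw [le_div_iff₀ hL, ← div_le_iff₀ hK]
    exact Int.le_ceil _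
  · have h := (Int.ceil_lt_add_one (s * ((L : ℕ) : ℝ) / ((K : ℕ) : ℝ))).le
    rw [← sub_le_iff_le_add, le_div_iff₀ hK] at h
    rw [sub_le_iff_le_add, div_add' _ _ _ hL.ne', div_le_div_iff_of_pos_right hL]
    linarith

lemma exists_grid_le (K L : ℕ+) (s : ℝ) :
    ∃ a : ℤ, (a : ℝ) * ((K : ℕ) : ℝ) / ((L : ℕ) : ℝ) ≤ s ∧
      s - (a : ℝ) * ((K : ℕ) : ℝ) / ((L : ℕ) : ℝ) ≤ ((K : ℕ) : ℝ) / ((L : ℕ) : ℝ) := by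
  obtain ⟨a, h1, h2⟩ := exists_grid_ge K L (-s)
  refine ⟨-a, ?_, ?_⟩ <;> push_cast <;> rw [neg_mul, neg_div] <;> linarith

lemma exists_subset_stripRect (K L : ℕ+) (k : ℤ) (s t : ℝ) :
    ∃ V ∈ UKL K L, V ⊆ stripRect K k s t ∧
      volume (stripRect K k s t \ V) ≤ ENNReal.ofReal (2 / ((L : ℕ) : ℝ)) := by
  obtain ⟨a, ha, ha'⟩ := exists_grid_ge K L s
  obtain ⟨b, hb, hb'⟩ := exists_grid_le K L t
  exact ⟨_, stripRect_mem_UKL K L k a b, Set.prod_mono subset_rfl (Set.Ico_subset_Ico ha hb),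
    volume_stripRect_diff_le k ha' hb'⟩

lemma exists_superset_stripRect (K L : ℕ+) (k : ℤ) (s t : ℝ) :
    ∃ V ∈ UKL K L, stripRect K k s t ⊆ V ∧
      volume (V \ stripRect K k s t) ≤ ENNReal.ofReal (2 / ((L : ℕ) : ℝ)) := by
  obtain ⟨a, ha, ha'⟩ := exists_grid_le K L s
  obtain ⟨b, hb, hb'⟩ := exists_grid_ge K L t
  exact ⟨_, stripRect_mem_UKL K L k a b, Set.prod_mono subset_rfl (Set.Ico_subset_Ico ha hb),
    volume_stripRect_diff_le k ha' hb'⟩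

lemma measure_biUnion_le_add_card {α ι : Type*} [MeasurableSpace α] (μ : Measure α)
    (F : Finset ι) (A B : ι → Set α) (δ : ENNReal) (h : ∀ i ∈ F, μ (A i \ B i) ≤ δ) :
    μ (⋃ i ∈ F, A i) ≤ μ (⋃ i ∈ F, B i) + F.card * δ := by
  have hsub : (⋃ i ∈ F, A i) ⊆ (⋃ i ∈ F, B i) ∪ ⋃ i ∈ F, (A i \ B i) := by
    intro x hx
    obtain ⟨i, hi, hxi⟩ := Set.mem_iUnion₂.1 hx
    by_cases hb : x ∈ B i
    · exact Or.inl (Set.mem_biUnion hi hb)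
    · exact Or.inr (Set.mem_biUnion hi ⟨hxi, hb⟩)
  refine (measure_mono hsub).trans ((measure_union_le _ _).trans ?_)
  gcongr
  refine (measure_biUnion_finset_le F _).trans ?_
  simpa using Finset.sum_le_sum h

lemma exists_subset_mem_UKL {K L : ℕ+} {U : Set (ℝ × ℝ)} (hU : U ∈ UKL K L) :
    ∃ c : ℕ, ∀ L' : ℕ+, ∃ V ∈ UKL K L', V ⊆ U ∧
      volume U ≤ volume V + c * ENNReal.ofReal (2 / ((L' : ℕ) : ℝ)) := by
  obtain ⟨F, rfl⟩ := hU
  refine ⟨F.card, fun L' => ?_⟩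
  choose V hV hsub hvol using fun i : ℤ × ℤ => exists_subset_stripRect K L' i.1
    ((i.2 : ℝ) * ((K : ℕ) : ℝ) / ((L : ℕ) : ℝ)) (((i.2 : ℝ) + 1) * ((K : ℕ) : ℝ) / ((L : ℕ) : ℝ))
  exact ⟨⋃ i ∈ F, V i, biUnion_mem_UKL F V fun i _ => hV i,
    Set.iUnion₂_mono fun i _ => hsub i,
    measure_biUnion_le_add_card _ F _ V _ fun i _ => hvol i⟩

lemma exists_superset_mem_UKL {K L : ℕ+} {U : Set (ℝ × ℝ)} (hU : U ∈ UKL K L) :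
    ∃ c : ℕ, ∀ L' : ℕ+, ∃ V ∈ UKL K L', U ⊆ V ∧
      volume V ≤ volume U + c * ENNReal.ofReal (2 / ((L' : ℕ) : ℝ)) := by
  obtain ⟨F, rfl⟩ := hU
  refine ⟨F.card, fun L' => ?_⟩
  choose V hV hsub hvol using fun i : ℤ × ℤ => exists_superset_stripRect K L' i.1
    ((i.2 : ℝ) * ((K : ℕ) : ℝ) / ((L : ℕ) : ℝ)) (((i.2 : ℝ) + 1) * ((K : ℕ) : ℝ) / ((L : ℕ) : ℝ))
  exact ⟨⋃ i ∈ F, V i, biUnion_mem_UKL F V fun i _ => hV i,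
    Set.iUnion₂_mono fun i _ => hsub i,
    measure_biUnion_le_add_card _ F V _ _ fun i _ => hvol i⟩

lemma exists_mem_of_not_bddAbove {P : Set ℕ} (hP : ¬ BddAbove P) (c : ℕ) {ε : NNReal}
    (hε : 0 < ε) :
    ∃ L : ℕ+, (L : ℕ) ∈ P ∧ (c : ENNReal) * ENNReal.ofReal (2 / ((L : ℕ) : ℝ)) ≤ ε := by
  obtain ⟨N, hN⟩ := exists_nat_gt ((c : ℝ) * 2 / ε)
  obtain ⟨n, hn, hNn⟩ := not_bddAbove_iff.1 hP N
  refine ⟨⟨n, by omega⟩, hn, ?_⟩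
  have hn0 : (0 : ℝ) < n := by exact_mod_cast (Nat.zero_le N).trans_lt hNn
  have hε' : (0 : ℝ) < ε := hε
  rw [← ENNReal.ofReal_natCast c, ← ENNReal.ofReal_mul (Nat.cast_nonneg c),
    ← ENNReal.ofReal_coe_nnreal]
  apply ENNReal.ofReal_le_ofReal
  have h : (c : ℝ) * 2 / ε < n := hN.trans (by exact_mod_cast hNn)
  rw [div_lt_iff₀ hε'] at h
  rw [PNat.mk_coe, ← mul_div_assoc, div_le_iff₀ hn0]
  linarith

/-- **Restricting `L` to an unbounded set of naturals gives the same contents**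
(Proposition 4.4, part 4, of the paper). -/
theorem stmt16 (P : Set ℕ) (hP : ¬ BddAbove P)
    (M : Set (ℝ × ℝ)) (hM : Bornology.IsBounded M) :
    volMinus M =
      (⨆ (K : ℕ+) (L : ℕ+) (_ : (L : ℕ) ∈ P) (U : Set (ℝ × ℝ))
          (_ : U ∈ UKL K L) (_ : U ⊆ M), volume U) ∧
    volPlus M =
      (⨅ (K : ℕ+) (L : ℕ+) (_ : (L : ℕ) ∈ P) (U : Set (ℝ × ℝ))
          (_ : U ∈ UKL K L) (_ : M ⊆ U), volume U) := by
  constructor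
  · apply le_antisymm
    · refine iSup₂_le fun K L => iSup₂_le fun U hU => iSup_le fun hUM => ?_
      refine ENNReal.le_of_forall_pos_le_add fun ε hε _ => ?_
      obtain ⟨c, hc⟩ := exists_subset_mem_UKL hU
      obtain ⟨L', hL', hle⟩ := exists_mem_of_not_bddAbove hP c hε
      obtain ⟨V, hV, hVU, hvol⟩ := hc L'
      refine hvol.trans (add_le_add ?_ hle)
      exact le_iSup₂_of_le K L' <| le_iSup₂_of_le hL' V <| le_iSup₂_of_le hV (hVU.trans hUM) le_rfl
    · refine iSup₂_le fun K L => iSup₂_le fun _ U => iSup₂_le fun hU hUM => ?_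
      exact le_iSup₂_of_le K L <| le_iSup₂_of_le U hU <| le_iSup_of_le hUM le_rfl
  · apply le_antisymm
    · refine le_iInf₂ fun K L => le_iInf₂ fun _ U => le_iInf₂ fun hU hUM => ?_
      exact iInf₂_le_of_le K L <| iInf₂_le_of_le U hU <| iInf_le_of_le hUM le_rfl
    · refine le_iInf₂ fun K L => le_iInf₂ fun U hU => le_iInf fun hUM => ?_
      refine ENNReal.le_of_forall_pos_le_add fun ε hε _ => ?_
      obtain ⟨c, hc⟩ := exists_superset_mem_UKL hU
      obtain ⟨L', hL', hle⟩ := exists_mem_of_not_bddAbove hP c hε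
      obtain ⟨V, hV, hUV, hvol⟩ := hc L'
      refine le_trans ?_ (hvol.trans (add_le_add le_rfl hle))
      exact iInf₂_le_of_le K L' <| iInf₂_le_of_le hL' V <| iInf₂_le_of_le hV (hUM.trans hUV) le_rfl
end
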